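/- arXiv:1710.01861 — 3 statements merged into one kernel-verified Lean document; each statement's English description precedes it below -/
import Mathlib

section
/- Let G be a finite nilpotent group that acts faithfully on a finite abelian group V with gcd(|G|,|V|) = 1. Then the number of conjugacy classes of the semidirect product G ⋉ V is at most |V|. -/
open Finset in
open scoped Classical in
theorem card_commute_fiber_le {X Y : Type*} [Group X] [Group Y] [Fintype X] (π : X →* Y) (a : X)
    (t : Y) :
    #{b : X | π b = t ∧ Commute a b} ≤ #{n : X | π n = 1 ∧ Commute a n} := by
  by_cases h : ∃ b₀, π b₀ = t ∧ Commute a b₀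
  · obtain ⟨b₀, hb, hc⟩ := h
    refine card_le_card_of_injOn (fun b ↦ b₀⁻¹ * b) ?_ (fun x _ y _ h ↦ mul_left_cancel h)
    intro b hb'
    simp only [coe_filter, mem_univ, true_and, Set.mem_ofPred_eq] at hb' ⊢
    exact ⟨by simp [hb, hb'.1], (hc.inv_right).mul_right hb'.2⟩
  · rw [filter_false_of_mem fun b _ hb ↦ h ⟨b, hb⟩]
    simp

open Finset in
open scoped Classical in
theorem card_commute_le_of_hom {X Y : Type*} [Group X] [Group Y] [Fintype X] [Fintype Y]
    (π : X →* Y) :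
    #{p : X × X | Commute p.1 p.2} ≤ #{p : Y × Y | Commute p.1 p.2} *
      #{p : X × X | (π p.1 = 1 ∧ π p.2 = 1) ∧ Commute p.1 p.2} := by
  have fib (s t : Y) : #{p : X × X | (π p.1 = s ∧ π p.2 = t) ∧ Commute p.1 p.2} ≤
      #{p : X × X | (π p.1 = 1 ∧ π p.2 = 1) ∧ Commute p.1 p.2} := by
    have e (s t : Y) : #{p : X × X | (π p.1 = s ∧ π p.2 = t) ∧ Commute p.1 p.2} =
        ∑ a : X with π a = s, #{b : X | π b = t ∧ Commute a b} := by
      rw [← univ_product_univ, card_filter, sum_product, sum_filter]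
      refine sum_congr rfl fun a _ ↦ ?_
      split_ifs with h <;> simp [h]
    have e' (s t : Y) : ∑ a : X with π a = s, #{b : X | π b = t ∧ Commute a b} =
        ∑ b : X with π b = t, #{a : X | π a = s ∧ Commute b a} := by
      simp_rw [card_filter, sum_filter]
      have : ∀ s t : Y, ∀ a : X, (if π a = s then ∑ b : X, if π b = t ∧ Commute a b then 1 else 0
          else 0) = ∑ b : X, if π a = s ∧ π b = t ∧ Commute a b then 1 else 0 := by
        intro s t a
        split_ifs with h <;> simp [h]
      simp_rw [this]
      rw [sum_comm]
      refine sum_congr rfl fun a _ ↦ sum_congr rfl fun b _ ↦ ?_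
      congr 1
      rw [commute_iff_eq, commute_iff_eq, eq_comm (a := b * a)]
      simp only [eq_iff_iff]
      tauto
    calc _ = _ := e s t
      _ ≤ ∑ a : X with π a = s, #{b : X | π b = 1 ∧ Commute a b} :=
        sum_le_sum fun a _ ↦ card_commute_fiber_le π a t
      _ = _ := e' s 1
      _ ≤ ∑ a : X with π a = 1, #{b : X | π b = 1 ∧ Commute a b} :=
        sum_le_sum fun a _ ↦ card_commute_fiber_le π a s
      _ = _ := (e 1 1).symm
  rw [card_eq_sum_card_fiberwise (f := fun p : X × X ↦ (π p.1, π p.2))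
    (t := {p : Y × Y | Commute p.1 p.2})]
  · refine sum_le_card_nsmul _ _ _ fun p _ ↦ le_trans (le_of_eq ?_) (fib p.1 p.2)
    congr 1
    ext x
    simp [Prod.ext_iff, and_comm]
  · intro p hp
    simp only [coe_filter, mem_univ, true_and, Set.mem_ofPred_eq] at hp ⊢
    exact hp.map π

/-- The number of conjugacy classes of an extension is at most the product of the numbers of
conjugacy classes of the kernel and of the quotient. -/
theorem card_conjClasses_le_mul {N X Y : Type*} [Group N] [Group X] [Group Y] [Finite X]
    (ι : N →* X) (hι : Function.Injective ι) (π : X →* Y) (hπ : Function.Surjective π)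
    (h : ι.range = π.ker) :
    Nat.card (ConjClasses X) ≤ Nat.card (ConjClasses N) * Nat.card (ConjClasses Y) := by
  classical
  have := Fintype.ofFinite X
  have : Finite Y := Finite.of_surjective π hπ
  have := Fintype.ofFinite Y
  have : Finite N := Finite.of_injective ι hι
  have cX := card_comm_eq_card_conjClasses_mul_card X
  have cY := card_comm_eq_card_conjClasses_mul_card Y
  have cN := card_comm_eq_card_conjClasses_mul_card N
  have hcard : Nat.card X = Nat.card N * Nat.card Y := by
    rw [← Subgroup.card_mul_index π.ker, ← h, Nat.card_congr (MonoidHom.ofInjective hι).toEquiv, h,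
      Subgroup.index_ker, MonoidHom.range_eq_top.mpr hπ, Subgroup.card_top]
  have key := card_commute_le_of_hom π
  have kN : Finset.card {p : X × X | (π p.1 = 1 ∧ π p.2 = 1) ∧ Commute p.1 p.2} =
      Nat.card {p : N × N // Commute p.1 p.2} := by
    rw [← Fintype.card_subtype, ← Nat.card_eq_fintype_card]
    symm
    refine Nat.card_eq_of_bijective (fun p ↦ ⟨(ι p.1.1, ι p.1.2), ⟨?_, ?_⟩, p.2.map ι⟩) ⟨?_, ?_⟩
    · exact h.le ⟨_, rfl⟩
    · exact h.le ⟨_, rfl⟩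
    · rintro ⟨⟨a, b⟩, _⟩ ⟨⟨c, d⟩, _⟩ e
      simpa [hι.eq_iff] using e
    · rintro ⟨⟨a, b⟩, ⟨ha, hb⟩, hc⟩
      obtain ⟨a, rfl⟩ := h.ge ha
      obtain ⟨b, rfl⟩ := h.ge hb
      refine ⟨⟨(a, b), ?_⟩, rfl⟩
      exact hι (by simpa using hc.eq)
  rw [kN, ← Fintype.card_subtype, ← Fintype.card_subtype, ← Nat.card_eq_fintype_card,
    ← Nat.card_eq_fintype_card, cX, cY, cN, hcard] at key
  have : 0 < Nat.card N * Nat.card Y := by rw [← hcard]; exact Nat.card_pos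
  refine Nat.le_of_mul_le_mul_right (key.trans_eq ?_) this
  ring

/-- The only subgroups of `V` that are stable under the action `φ` are the trivial ones. -/
def IsIrreducibleAction {G V : Type*} [Group G] [Group V] (φ : G →* MulAut V) : Prop :=
  ∀ W : Subgroup V, (∀ g, ∀ w ∈ W, φ g w ∈ W) → W = ⊥ ∨ W = ⊤

/-- The action on an invariant subgroup. -/
def restrictAction {G V : Type*} [Group G] [Group V] (φ : G →* MulAut V) (W : Subgroup V)
    (hW : ∀ g, ∀ w ∈ W, φ g w ∈ W) : G →* MulAut W where
  toFun g :=
    { toFun := fun w ↦ ⟨φ g w, hW g w w.2⟩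
      invFun := fun w ↦ ⟨φ g⁻¹ w, hW g⁻¹ w w.2⟩
      left_inv := fun w ↦ by simp
      right_inv := fun w ↦ by simp
      map_mul' := fun a b ↦ by ext; simp }
  map_one' := by ext; simp
  map_mul' g h := by ext; simp

@[simp]
theorem coe_restrictAction {G V : Type*} [Group G] [Group V] (φ : G →* MulAut V) (W : Subgroup V)
    (hW : ∀ g, ∀ w ∈ W, φ g w ∈ W) (g : G) (w : W) :
    (restrictAction φ W hW g w : V) = φ g w := rfl

/-- The action on the quotient by an invariant subgroup. -/
def quotientAction {G V : Type*} [Group G] [Group V] (φ : G →* MulAut V) (W : Subgroup V)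
    [W.Normal] (hW : ∀ g, ∀ w ∈ W, φ g w ∈ W) : G →* MulAut (V ⧸ W) where
  toFun g := QuotientGroup.congr W W (φ g) (by
    ext w
    refine ⟨?_, fun hw ↦ ⟨φ g⁻¹ w, hW _ _ hw, by simp⟩⟩
    rintro ⟨w, hw, rfl⟩
    exact hW g w hw)
  map_one' := by
    ext x
    induction x using QuotientGroup.induction_on
    simp
  map_mul' g h := by
    ext x
    induction x using QuotientGroup.induction_on
    simp

/-- A power coprime to the order of a finite group is injective on fixed elements. -/
theorem eq_one_of_pow_eq_one_of_coprime {V : Type*} [Group V] {w : V} {n : ℕ}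
    (h : w ^ n = 1) (hn : n.Coprime (Nat.card V)) : w = 1 := by
  rw [← pow_one w, ← hn, pow_gcd_eq_one]
  exact ⟨h, pow_card_eq_one'⟩

/-- If an automorphism `g` moves `u` by an element fixed by `g`, then this element is killed by the
order of `g`. -/
theorem pow_orderOf_eq_one_of_smul_eq_mul {G V : Type*} [Group G] [CommGroup V]
    (φ : G →* MulAut V) {g : G} {u w : V} (hu : φ g u = u * w) (hw : φ g w = w) :
    w ^ orderOf g = 1 := by
  have h (n : ℕ) : φ (g ^ n) u = u * w ^ n := by
    induction n with
    | zero => simp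
    | succ n ih =>
      rw [pow_succ', map_mul, MulAut.mul_apply, ih, map_mul, hu, map_pow, hw, mul_assoc,
        ← pow_succ']
  simpa [pow_orderOf_eq_one] using h (orderOf g)

theorem card_conjClasses_semidirectProduct_le_of_irreducible.{u, v}
    (H : ∀ (G : Type u) (V : Type v) [Group G] [Finite G] [Group.IsNilpotent G] [CommGroup V]
      [Finite V] [Nontrivial V] (φ : G →* MulAut V), Function.Injective φ →
      (Nat.card G).Coprime (Nat.card V) → IsIrreducibleAction φ →
      Nat.card (ConjClasses (V ⋊[φ] G)) ≤ Nat.card V)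
    (G : Type u) (V : Type v) [Group G] [Finite G] [Group.IsNilpotent G] [CommGroup V]
    [Finite V] (φ : G →* MulAut V) (hφ : Function.Injective φ)
    (hc : (Nat.card G).Coprime (Nat.card V)) :
    Nat.card (ConjClasses (V ⋊[φ] G)) ≤ Nat.card V := by
  induction hn : Nat.card V using Nat.strong_induction_on generalizing G V with
  | _ n ih =>
  subst hn
  rcases subsingleton_or_nontrivial V with hV | hV
  · have : Subsingleton G := ⟨fun a b ↦ hφ (by ext x; exact Subsingleton.elim _ _)⟩
    have : Subsingleton (V ⋊[φ] G) := ⟨fun a b ↦ SemidirectProduct.ext (Subsingleton.elim _ _)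
      (Subsingleton.elim _ _)⟩
    have : Subsingleton (ConjClasses (V ⋊[φ] G)) :=
      ConjClasses.mk_surjective.subsingleton
    exact (Finite.card_le_one_iff_subsingleton.mpr this).trans Nat.card_pos
  by_cases hirr : IsIrreducibleAction φ
  · exact H G V φ hφ hc hirr
  simp only [IsIrreducibleAction, not_forall, not_or] at hirr
  obtain ⟨W, hW, hbot, htop⟩ := hirr
  have hcW := Subgroup.card_mul_index W
  have hW1 : 1 < Nat.card W := Subgroup.one_lt_card_iff_ne_bot W |>.mpr hbot
  have hW2 : 1 < W.index := by
    have : W.index ≠ 1 := fun h ↦ htop (Subgroup.index_eq_one.mp h)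
    have := Subgroup.index_ne_zero_of_finite (H := W)
    omega
  have hidx : Nat.card (V ⧸ W) = W.index := rfl
  set ψ := quotientAction φ W hW with hψ
  set K := ψ.ker
  set φK := (restrictAction φ W hW).comp K.subtype with hφK
  have hφKinj : Function.Injective φK := by
    rw [injective_iff_map_eq_one]
    rintro ⟨g, hg⟩ h1
    rw [Subtype.ext_iff]
    refine (injective_iff_map_eq_one φ).mp hφ g ?_
    ext u
    have h2 : ∀ w ∈ W, φ g w = w := fun w hw ↦
      congrArg (fun f : MulAut W ↦ ((f ⟨w, hw⟩ : W) : V)) h1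
    have h3 : u⁻¹ * φ g u ∈ W := by
      rw [← QuotientGroup.eq]
      exact (DFunLike.congr_fun (MonoidHom.mem_ker.mp hg) (u : V ⧸ W)).symm
    have h4 := pow_orderOf_eq_one_of_smul_eq_mul φ (g := g) (u := u) (w := u⁻¹ * φ g u)
      (by simp) (h2 _ h3)
    have h5 := eq_one_of_pow_eq_one_of_coprime h4 (hc.coprime_dvd_left (orderOf_dvd_natCard g))
    exact (inv_mul_eq_one.mp h5).symm
  have i1 := ih (Nat.card W) (by nlinarith) K W φK hφKinj
    ((hc.coprime_dvd_left (Subgroup.card_subgroup_dvd_card K)).coprime_dvd_right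
      (Subgroup.card_subgroup_dvd_card W)) rfl
  have i2 := ih (Nat.card (V ⧸ W)) (by rw [hidx]; nlinarith) (G ⧸ K) (V ⧸ W)
    (QuotientGroup.kerLift ψ) (QuotientGroup.kerLift_injective ψ)
    ((hc.coprime_dvd_left (Subgroup.card_quotient_dvd_card K)).coprime_dvd_right
      (Subgroup.card_quotient_dvd_card W)) rfl
  rw [← hcW]
  let ι : W ⋊[φK] K →* V ⋊[φ] G := SemidirectProduct.map W.subtype K.subtype
    (fun g ↦ by ext w; rfl)
  let π : V ⋊[φ] G →* (V ⧸ W) ⋊[QuotientGroup.kerLift ψ] (G ⧸ K) :=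
    SemidirectProduct.map (QuotientGroup.mk' W) (QuotientGroup.mk' K) (fun g ↦ by ext w; rfl)
  have : Finite (V ⋊[φ] G) := Finite.of_equiv _ SemidirectProduct.equivProd.symm
  refine (card_conjClasses_le_mul ι ?_ π ?_ ?_).trans (Nat.mul_le_mul i1 i2)
  · intro a b h
    have h1 := congrArg SemidirectProduct.left h
    have h2 := congrArg SemidirectProduct.right h
    exact SemidirectProduct.ext (Subtype.ext h1) (Subtype.ext h2)
  · rintro ⟨a, b⟩
    obtain ⟨a, rfl⟩ := QuotientGroup.mk_surjective a
    obtain ⟨b, rfl⟩ := QuotientGroup.mk_surjective b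
    exact ⟨⟨a, b⟩, rfl⟩
  · ext ⟨a, b⟩
    rw [MonoidHom.mem_ker, SemidirectProduct.ext_iff]
    have e1 : (π ⟨a, b⟩).left = (a : V ⧸ W) := rfl
    have e2 : (π ⟨a, b⟩).right = (b : G ⧸ K) := rfl
    rw [e1, e2, SemidirectProduct.one_left, SemidirectProduct.one_right, QuotientGroup.eq_one_iff,
      QuotientGroup.eq_one_iff]
    constructor
    · rintro ⟨⟨x, y⟩, hxy⟩
      have h1 : (x : V) = a := congrArg SemidirectProduct.left hxy
      have h2 : (y : G) = b := congrArg SemidirectProduct.right hxy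
      exact ⟨h1 ▸ x.2, h2 ▸ y.2⟩
    · rintro ⟨ha, hb⟩
      exact ⟨⟨⟨a, ha⟩, ⟨b, hb⟩⟩, rfl⟩

/-- The trace of an integral matrix over an algebraically closed field is integral. -/
theorem Matrix.isIntegral_trace_of_isIntegral {F n : Type*} [Field F] [IsAlgClosed F] [Fintype n]
    [DecidableEq n] {M : Matrix n n F} (hM : IsIntegral ℤ M) : IsIntegral ℤ M.trace := by
  rw [Matrix.trace_eq_sum_roots_charpoly_of_splits (IsAlgClosed.splits _)]
  refine IsIntegral.multiset_sum fun x hx ↦ ?_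
  obtain ⟨p, hp, hp0⟩ := hM
  refine ⟨p, hp, ?_⟩
  have hx' : x ∈ spectrum F M :=
    Matrix.mem_spectrum_iff_isRoot_charpoly.mpr (Polynomial.isRoot_of_mem_roots hx)
  have h1 := spectrum.subset_polynomial_aeval M (p.map (algebraMap ℤ F)) ⟨x, hx', rfl⟩
  have h2 : Polynomial.aeval M (p.map (algebraMap ℤ F)) = 0 := by
    rw [Polynomial.aeval_map_algebraMap]
    exact hp0
  rw [h2] at h1
  by_cases hn : Nonempty n
  · rw [spectrum.zero_eq, Set.mem_singleton_iff] at h1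
    rw [← Polynomial.eval_map]
    exact h1
  · have : IsEmpty n := not_nonempty_iff.mp hn
    have : (0 : Matrix n n F) = 1 := Subsingleton.elim _ _
    rw [this, spectrum.mem_iff] at h1
    exact absurd (isUnit_of_subsingleton _) h1

/-- Averages over a group of traces of the products of a representation with a commuting matrix of
finite order are integral. -/
theorem isIntegral_average_trace {F n H : Type*} [Field F] [CharZero F] [IsAlgClosed F] [Fintype n]
    [DecidableEq n] [Group H] [Fintype H] (R : H →* Matrix n n F) (M : Matrix n n F)
    (hM : ∀ h, Commute M (R h)) {m : ℕ} (hm : 0 < m) (hMm : M ^ m = 1) :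
    IsIntegral ℤ ((Fintype.card H : F)⁻¹ * ∑ h, (R h * M).trace) := by
  have hc : (Fintype.card H : F) ≠ 0 := Nat.cast_ne_zero.mpr Fintype.card_ne_zero
  set S : Matrix n n F := ∑ h, R h with hS
  have hRS (h : H) : R h * S = S := by
    rw [hS, Finset.mul_sum]
    simp_rw [← map_mul]
    exact Equiv.sum_comp (Equiv.mulLeft h) (fun x ↦ R x)
  have hSS : S * S = (Fintype.card H : F) • S := by
    conv_lhs => rw [hS, Finset.sum_mul]
    simp [← hS, hRS, Nat.cast_smul_eq_nsmul]
  set E : Matrix n n F := (Fintype.card H : F)⁻¹ • S with hE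
  have hEE : IsIdempotentElem E := by
    rw [IsIdempotentElem, hE, smul_mul_smul_comm, hSS, smul_smul, mul_assoc, inv_mul_cancel₀ hc,
      mul_one]
  have hEM : Commute E M := by
    refine Commute.smul_left ?_ _
    exact Commute.sum_left _ _ _ fun h _ ↦ (hM h).symm
  have h1 : (Fintype.card H : F)⁻¹ * ∑ h, (R h * M).trace = (E * M).trace := by
    rw [hE, Matrix.smul_mul, Matrix.trace_smul, hS, Finset.sum_mul, Matrix.trace_sum, smul_eq_mul]
  rw [h1]
  refine Matrix.isIntegral_trace_of_isIntegral ⟨Polynomial.X ^ (m + 1) - Polynomial.X, ?_, ?_⟩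
  · exact Polynomial.monic_X_pow_sub (by
      rw [Polynomial.degree_X]
      exact_mod_cast Nat.lt_add_of_pos_left hm)
  · simp only [Polynomial.eval₂_sub, Polynomial.eval₂_X, Polynomial.eval₂_X_pow]
    rw [hEM.mul_pow, hEE.pow_succ_eq, pow_succ, hMm, one_mul, sub_self]

open Matrix ComplexOrder in
/-- Complex characters of finite groups take conjugate values on inverse elements. -/
theorem trace_map_inv_eq_conj {n X : Type*} [Fintype n] [DecidableEq n] [Group X] [Finite X]
    (R : X →* Matrix n n ℂ) (x : X) : (R x⁻¹).trace = star (R x).trace := by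
  have := Fintype.ofFinite X
  set P : Matrix n n ℂ := ∑ y, (R y)ᴴ * R y with hP
  have hpos : P.PosDef := by
    classical
    rw [hP, ← Finset.add_sum_erase _ _ (Finset.mem_univ (1 : X))]
    refine Matrix.PosDef.add_posSemidef (by simpa using Matrix.PosDef.one) ?_
    exact Matrix.posSemidef_sum _ fun y _ ↦ Matrix.posSemidef_conjTranspose_mul_self _
  have h1 : (R x)ᴴ * P * R x = P := by
    rw [hP, Finset.mul_sum, Finset.sum_mul]
    simp_rw [show ∀ y, (R x)ᴴ * ((R y)ᴴ * R y) * R x = (R (y * x))ᴴ * R (y * x) by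
      intro y; simp [Matrix.conjTranspose_mul, mul_assoc]]
    exact Equiv.sum_comp (Equiv.mulRight x) (fun y ↦ (R y)ᴴ * R y)
  have h2 : (R x)ᴴ * P = P * R x⁻¹ := by
    conv_rhs => rw [← h1]
    rw [mul_assoc _ (R x), ← map_mul, mul_inv_cancel, map_one, mul_one]
  have hu : IsUnit P := hpos.isUnit
  have h3 : R x⁻¹ = P⁻¹ * ((R x)ᴴ * P) := by
    rw [h2, ← mul_assoc,
      Matrix.nonsing_inv_mul _ ((Matrix.isUnit_iff_isUnit_det _).mp hu), one_mul]
  rw [h3, Matrix.trace_mul_comm, mul_assoc,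
    Matrix.mul_nonsing_inv _ ((Matrix.isUnit_iff_isUnit_det _).mp hu),
    mul_one, Matrix.trace_conjTranspose]

/-- Functions on a group of the form `h ↦ tr (R h * M)`, where `R` is a matrix representation and
`M` is a matrix of finite order commuting with its image. -/
def IsTraceFunction {H F : Type*} [Group H] [Field F] (η : H → F) : Prop :=
  ∃ (d : ℕ) (R : H →* Matrix (Fin d) (Fin d) F) (M : Matrix (Fin d) (Fin d) F) (m : ℕ),
    0 < m ∧ M ^ m = 1 ∧ (∀ h, Commute M (R h)) ∧ ∀ h, η h = (R h * M).trace

namespace IsTraceFunction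

variable {H F : Type*} [Group H] [Field F]

theorem of_matrix {n : Type*} [Fintype n] [DecidableEq n] {η : H → F} (R : H →* Matrix n n F)
    (M : Matrix n n F) {m : ℕ} (hm : 0 < m) (hMm : M ^ m = 1) (hM : ∀ h, Commute M (R h))
    (hη : ∀ h, η h = (R h * M).trace) : IsTraceFunction η := by
  let e := Matrix.reindexAlgEquiv F F (Fintype.equivFin n)
  refine ⟨Fintype.card n, (e : _ →* _).comp R, e M, m, hm, by rw [← map_pow, hMm, map_one],
    fun h ↦ (hM h).map e, fun h ↦ ?_⟩
  have : ((e : Matrix n n F →* _).comp R) h * e M = e (R h * M) := by simp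
  rw [hη, this]
  simp [e, Matrix.trace, Matrix.coe_reindexAlgEquiv, Matrix.reindex_apply,
    Matrix.submatrix_apply, Equiv.sum_comp (Fintype.equivFin n).symm
    (fun i ↦ (R h * M) i i), Matrix.diag]

open scoped Kronecker in
theorem mul {η η' : H → F} (h₁ : IsTraceFunction η) (h₂ : IsTraceFunction η') :
    IsTraceFunction (fun h ↦ η h * η' h) := by
  obtain ⟨d, R, M, m, hm, hMm, hM, hη⟩ := h₁
  obtain ⟨d', R', M', m', hm', hMm', hM', hη'⟩ := h₂
  refine of_matrix
    { toFun := fun h ↦ R h ⊗ₖ R' h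
      map_one' := by simp
      map_mul' := fun a b ↦ by simp [Matrix.mul_kronecker_mul] } (M ⊗ₖ M') (m := m * m')
    (Nat.mul_pos hm hm') ?_ (fun h ↦ ?_) (fun h ↦ ?_)
  · have (k : ℕ) : (M ⊗ₖ M') ^ k = (M ^ k) ⊗ₖ (M' ^ k) := by
      induction k with
      | zero => simp
      | succ k ih => rw [pow_succ, ih, ← Matrix.mul_kronecker_mul, ← pow_succ, ← pow_succ]
    rw [this, pow_mul, hMm, one_pow, mul_comm m, pow_mul, hMm', one_pow, Matrix.one_kronecker_one]
  · change M ⊗ₖ M' * R h ⊗ₖ R' h = R h ⊗ₖ R' h * M ⊗ₖ M'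
    rw [← Matrix.mul_kronecker_mul, ← Matrix.mul_kronecker_mul, (hM h).eq, (hM' h).eq]
  · change _ = (R h ⊗ₖ R' h * M ⊗ₖ M').trace
    rw [← Matrix.mul_kronecker_mul, Matrix.trace_kronecker, hη, hη']

theorem one : IsTraceFunction (fun _ : H ↦ (1 : F)) :=
  of_matrix (n := Unit) 1 1 one_pos (one_pow 1) (fun _ ↦ Commute.one_left _) (by simp)

theorem pow {η : H → F} (hη : IsTraceFunction η) (k : ℕ) : IsTraceFunction (fun h ↦ η h ^ k) := by
  induction k with
  | zero => simpa using one
  | succ k ih => simpa only [pow_succ] using ih.mul hη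

theorem isIntegral_average [Fintype H] [CharZero F] [IsAlgClosed F] {η : H → F}
    (hη : IsTraceFunction η) : IsIntegral ℤ ((Fintype.card H : F)⁻¹ * ∑ h, η h) := by
  obtain ⟨d, R, M, m, hm, hMm, hM, hη⟩ := hη
  simp_rw [hη]
  exact isIntegral_average_trace R M hM hm hMm

open scoped Classical in
/-- Weighted fixed point counts, where the weights are roots of unity that are constant on orbits,
are trace functions. -/
theorem sum_fixedPoints {V : Type*} [Fintype V] (φ : H →* Equiv.Perm V)
    (c : V → F) {m : ℕ} (hm : 0 < m) (hcm : ∀ u, c u ^ m = 1) (hc : ∀ h u, c (φ h u) = c u) :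
    IsTraceFunction (fun h ↦ ∑ u with φ h u = u, c u) := by
  refine of_matrix
    { toFun := fun h ↦ Matrix.of fun i j ↦ if i = φ h j then 1 else 0
      map_one' := by
        ext i j
        simp [Matrix.one_apply]
      map_mul' := fun a b ↦ by
        ext i j
        simp [Matrix.mul_apply] } (Matrix.diagonal c) hm ?_ (fun h ↦ ?_) (fun h ↦ ?_)
  · rw [Matrix.diagonal_pow, ← Matrix.diagonal_one]
    congr 1
    ext u
    simp [hcm]
  · ext i j
    simp only [MonoidHom.coe_mk, OneHom.coe_mk, Matrix.diagonal_mul, Matrix.mul_diagonal,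
      Matrix.of_apply]
    split_ifs with h
    · rw [h, hc, mul_comm]
    · simp
  · simp [Matrix.trace, Matrix.mul_diagonal, Finset.sum_filter, eq_comm]

end IsTraceFunction

/-- The trace of the two-sided multiplication `x ↦ a * x * b` on a product of matrix algebras. -/
theorem trace_mulLeftRight_pi_matrix {F ι : Type*} [Field F] [Fintype ι] [DecidableEq ι] {d : ι → ℕ}
    (a b : ∀ i, Matrix (Fin (d i)) (Fin (d i)) F) :
    LinearMap.trace F _ (LinearMap.mulLeftRight F (a, b)) = ∑ i, (a i).trace * (b i).trace := by
  rw [LinearMap.trace_eq_matrix_trace F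
    (Pi.basis fun i ↦ Matrix.stdBasis F (Fin (d i)) (Fin (d i)))]
  rw [Matrix.trace, Fintype.sum_sigma]
  refine Finset.sum_congr rfl fun i _ ↦ ?_
  rw [Fintype.sum_prod_type, Matrix.trace, Matrix.trace, Finset.sum_mul_sum]
  refine Finset.sum_congr rfl fun r _ ↦ Finset.sum_congr rfl fun s _ ↦ ?_
  rw [Matrix.diag_apply, LinearMap.toMatrix_apply, Pi.basis_repr, Pi.basis_apply,
    Matrix.stdBasis_eq_single]
  simp [LinearMap.mulLeftRight_apply, Matrix.stdBasis, Matrix.mul_apply, Matrix.single_apply,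
    ite_and]

open scoped Classical in
/-- The trace of the two-sided translation `y ↦ a * y * b` on a group algebra. -/
theorem trace_mulLeftRight_monoidAlgebra {F X : Type*} [Field F] [Group X] [Fintype X] (a b : X) :
    LinearMap.trace F _ (LinearMap.mulLeftRight F
      (MonoidAlgebra.of F X a, MonoidAlgebra.of F X b)) =
        ({y : X | a * y * b = y} : Finset X).card := by
  rw [LinearMap.trace_eq_matrix_trace F (MonoidAlgebra.basis X F), Matrix.trace]
  simp [LinearMap.toMatrix_apply, MonoidAlgebra.basis, MonoidAlgebra.single_mul_single,
    LinearMap.mulLeftRight_apply, Finsupp.single_apply]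

open scoped Classical in
theorem exists_matrix_representations (F X : Type*) [Field F] [IsAlgClosed F] [CharZero F] [Group X]
    [Fintype X] : ∃ (n : ℕ) (d : Fin n → ℕ) (ρ : ∀ i, X →* Matrix (Fin (d i)) (Fin (d i)) F),
      (∀ i, d i ≠ 0) ∧ (∀ i, Submodule.span F (Set.range (ρ i)) = ⊤) ∧
      ∀ a b, ∑ i, (ρ i a).trace * (ρ i b).trace = ({y : X | a * y * b = y} : Finset X).card := by
  obtain ⟨n, d, hd, ⟨e⟩⟩ :=
    IsSemisimpleRing.exists_algEquiv_pi_matrix_of_isAlgClosed F (MonoidAlgebra F X)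
  refine ⟨n, d, fun i ↦ (((Pi.evalAlgHom F _ i).comp e.toAlgHom : _ →* _)).comp
    (MonoidAlgebra.of F X), fun i ↦ (hd i).out, fun i ↦ ?_, fun a b ↦ ?_⟩
  · let L : MonoidAlgebra F X →ₗ[F] Matrix (Fin (d i)) (Fin (d i)) F :=
      ((Pi.evalAlgHom F _ i).comp e.toAlgHom).toLinearMap
    have hL : Function.Surjective L :=
      (Function.surjective_eval i).comp e.surjective
    have h1 : Submodule.span F (Set.range (MonoidAlgebra.of F X)) = ⊤ := by
      rw [eq_top_iff, ← (MonoidAlgebra.basis X F).span_eq]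
      refine Submodule.span_mono ?_
      rintro _ ⟨x, rfl⟩
      exact ⟨x, by simp [MonoidAlgebra.basis]⟩
    have h2 := congrArg (Submodule.map L) h1
    rw [Submodule.map_span, Submodule.map_top, LinearMap.range_eq_top.mpr hL,
      ← Set.range_comp] at h2
    exact h2
  · rw [← trace_mulLeftRight_monoidAlgebra (F := F), ← LinearMap.trace_conj' _ e.toLinearEquiv]
    have : e.toLinearEquiv.conj (LinearMap.mulLeftRight F
        (MonoidAlgebra.of F X a, MonoidAlgebra.of F X b)) =
        LinearMap.mulLeftRight F (e (MonoidAlgebra.of F X a), e (MonoidAlgebra.of F X b)) := by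
      refine LinearMap.ext fun x ↦ ?_
      simp [LinearEquiv.conj_apply, LinearMap.mulLeftRight_apply]
    rw [this, trace_mulLeftRight_pi_matrix]
    rfl

open scoped Classical in
theorem card_conjClasses_le_of_sum_trace {F X ι : Type*} [Field F] [CharZero F] [Group X]
    [Fintype X]
    [Fintype ι] (χ : ι → X → F)
    (h : ∀ a b, ∑ i, χ i a * χ i b = ({y : X | a * y * b = y} : Finset X).card) :
    Nat.card (ConjClasses X) ≤ Fintype.card ι := by
  set r : ConjClasses X → X := Quotient.out with hr
  have hmk (c : ConjClasses X) : ConjClasses.mk (r c) = c := Quotient.out_eq c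
  let A : Matrix (ConjClasses X) ι F := Matrix.of fun c i ↦ χ i (r c)
  let B : Matrix ι (ConjClasses X) F := Matrix.of fun i c ↦ χ i (r c)⁻¹
  let D : ConjClasses X → F := fun c ↦ ({y : X | r c * y * (r c)⁻¹ = y} : Finset X).card
  have hD (c) : D c ≠ 0 := by
    simp only [D, Ne, Nat.cast_eq_zero, Finset.card_eq_zero]
    exact Finset.ne_empty_of_mem (a := 1) (by simp)
  have hAB : A * B = Matrix.diagonal D := by
    ext c c'
    rw [Matrix.mul_apply]
    simp only [A, B, Matrix.of_apply, h]
    by_cases hc : c = c'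
    · subst hc
      simp [D]
    · rw [Matrix.diagonal_apply_ne _ hc, Nat.cast_eq_zero, Finset.card_eq_zero,
        Finset.filter_eq_empty_iff]
      intro y _ hy
      apply hc
      rw [← hmk c, ← hmk c', ConjClasses.mk_eq_mk_iff_isConj, isConj_iff]
      refine ⟨y⁻¹, ?_⟩
      rw [mul_inv_eq_iff_eq_mul] at hy
      rw [inv_inv, mul_assoc, hy, inv_mul_cancel_left]
  have hrank : (A * B).rank = Fintype.card (ConjClasses X) := by
    rw [hAB]
    refine Matrix.rank_of_isUnit _ ?_
    rw [Matrix.isUnit_diagonal, Pi.isUnit_iff]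
    exact fun c ↦ (hD c).isUnit
  rw [Nat.card_eq_fintype_card, ← hrank]
  exact (Matrix.rank_mul_le_left A B).trans (Matrix.rank_le_card_width A)

/-- A sum of nonzero algebraic integers all of whose conjugates are positive reals, if it is a
rational integer, is at least the number of summands. -/
theorem card_le_of_sum_totallyPositive {F ι : Type*} [Field F] [CharZero F]
    [Algebra.IsAlgebraic ℚ F] [Fintype ι] (n : ι → F) (hint : ∀ i, IsIntegral ℤ (n i))
    (hpos : ∀ (τ : F →+* ℂ) (i : ι), ∃ r : ℝ, 0 < r ∧ τ (n i) = r) {N : ℕ}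
    (hsum : ∑ i, n i = N) : Fintype.card ι ≤ N := by
  classical
  set K := IntermediateField.adjoin ℚ (Set.range n) with hK
  have hfin : FiniteDimensional ℚ K :=
    IntermediateField.finiteDimensional_adjoin fun x _ ↦ Algebra.IsIntegral.isIntegral x
  let m : ι → K := fun i ↦ ⟨n i, IntermediateField.subset_adjoin _ _ ⟨i, rfl⟩⟩
  have hext (σ : K →ₐ[ℚ] ℂ) : ∃ τ : F →+* ℂ, ∀ x : K, τ x = σ x := by
    algebraize [σ.toRingHom]
    refine ⟨(IsAlgClosed.lift (R := K) (S := F) (M := ℂ)).toRingHom, fun x ↦ ?_⟩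
    exact (IsAlgClosed.lift (R := K) (S := F) (M := ℂ)).commutes x
  have hr (σ : K →ₐ[ℚ] ℂ) (i : ι) : ∃ r : ℝ, 0 < r ∧ σ (m i) = r := by
    obtain ⟨τ, hτ⟩ := hext σ
    rw [← hτ]
    exact hpos τ i
  choose r hr0 hr using hr
  have hsumr (σ : K →ₐ[ℚ] ℂ) : ∑ i, r σ i = N := by
    have h1 : ∑ i, m i = N := Subtype.ext (by simpa [m] using hsum)
    have h2 := congrArg σ h1
    rw [map_sum, map_natCast] at h2
    simp_rw [hr] at h2
    exact_mod_cast h2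
  have hprod (i : ι) : 1 ≤ ∏ σ : K →ₐ[ℚ] ℂ, r σ i := by
    have h1 := Algebra.norm_eq_prod_embeddings ℚ ℂ (m i)
    simp_rw [hr] at h1
    have h2 : IsIntegral ℤ (Algebra.norm ℚ (m i)) := by
      refine Algebra.isIntegral_norm ℚ ?_
      exact (isIntegral_algebraMap_iff (B := F) (algebraMap K F).injective).mp (hint i)
    obtain ⟨z, hz⟩ := IsIntegrallyClosed.isIntegral_iff.mp h2
    rw [← hz] at h1
    have h3 : (z : ℝ) = ∏ σ : K →ₐ[ℚ] ℂ, r σ i := by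
      have : ((z : ℝ) : ℂ) = ((∏ σ : K →ₐ[ℚ] ℂ, r σ i : ℝ) : ℂ) := by
        push_cast
        simpa using h1
      exact_mod_cast this
    rw [← h3]
    have : (0 : ℝ) < z := h3 ▸ Finset.prod_pos fun σ _ ↦ hr0 σ i
    exact_mod_cast Int.add_one_le_iff.mpr (by exact_mod_cast this : 0 < z)
  have h1 : (0 : ℝ) ≤ ∑ i, ∑ σ : K →ₐ[ℚ] ℂ, (r σ i - 1) := by
    refine Finset.sum_nonneg fun i _ ↦ ?_
    calc (0 : ℝ) ≤ Real.log (∏ σ : K →ₐ[ℚ] ℂ, r σ i) := Real.log_nonneg (hprod i)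
      _ = ∑ σ : K →ₐ[ℚ] ℂ, Real.log (r σ i) := Real.log_prod fun σ _ ↦ (hr0 σ i).ne'
      _ ≤ _ := Finset.sum_le_sum fun σ _ ↦ Real.log_le_sub_one_of_pos (hr0 σ i)
  rw [Finset.sum_comm] at h1
  simp_rw [Finset.sum_sub_distrib, hsumr] at h1
  simp only [Finset.sum_const, Finset.card_univ, nsmul_eq_mul, mul_one] at h1
  have h2 : (0 : ℝ) < Fintype.card (K →ₐ[ℚ] ℂ) := by
    rw [AlgHom.card]
    exact_mod_cast Module.finrank_pos
  by_contra! hlt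
  have : (N : ℝ) < Fintype.card ι := by exact_mod_cast hlt
  nlinarith [mul_pos h2 (sub_pos.mpr this)]

theorem sum_units_hom_eq_zero {F V : Type*} [Field F] [CommGroup V] [Fintype V]
    {lam : V →* Fˣ} (h : lam ≠ 1) : ∑ u, (lam u : F) = 0 := by
  classical
  have h1 := sum_hom_units ((Units.coeHom F).comp lam)
  rw [if_neg, Nat.cast_zero] at h1
  · exact h1
  · intro h2
    exact h (MonoidHom.ext fun u ↦ Units.ext (DFunLike.congr_fun h2 u))

open scoped Classical in
theorem sum_dual_apply {F V : Type*} [Field F] [CharZero F] [CommGroup V] [Fintype V]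
    [IsAlgClosed F] [Fintype (V →* Fˣ)] (u : V) :
    ∑ lam : V →* Fˣ, (lam u : F) = if u = 1 then (Fintype.card V : F) else 0 := by
  split_ifs with h
  · subst h
    simp only [map_one, Units.val_one, Finset.sum_const, Finset.card_univ, nsmul_eq_mul, mul_one]
    rw [← Nat.card_eq_fintype_card, CommGroup.card_monoidHom_of_hasEnoughRootsOfUnity,
      Nat.card_eq_fintype_card]
  · obtain ⟨μ, hμ⟩ := CommGroup.exists_apply_ne_one_of_hasEnoughRootsOfUnity V F h
    have h1 : ∑ lam : V →* Fˣ, (lam u : F) = μ u * ∑ lam : V →* Fˣ, (lam u : F) := by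
      rw [Finset.mul_sum, ← Equiv.sum_comp (Equiv.mulLeft μ)]
      simp
    have h2 : ((μ u : F) - 1) * ∑ lam : V →* Fˣ, (lam u : F) = 0 := by
      rw [sub_mul, one_mul, ← h1, sub_self]
    exact (mul_eq_zero.mp h2).resolve_left fun h3 ↦ hμ (Units.ext (sub_eq_zero.mp h3))

/-- Schur's lemma, for matrices. -/
theorem exists_eq_scalar_of_commute {F X n : Type*} [Field F] [Group X] [Fintype n] [DecidableEq n]
    (R : X →* Matrix n n F) (hR : Submodule.span F (Set.range R) = ⊤) (T : Matrix n n F)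
    (hT : ∀ x, Commute T (R x)) : ∃ c : F, T = Matrix.scalar n c := by
  have h (M : Matrix n n F) : Commute T M := by
    have hM : M ∈ Submodule.span F (Set.range R) := hR ▸ Submodule.mem_top
    induction hM using Submodule.span_induction with
    | mem x hx => obtain ⟨x, rfl⟩ := hx; exact hT x
    | zero => exact Commute.zero_right _
    | add x y _ _ hx hy => exact hx.add_right hy
    | smul a x _ hx => exact hx.smul_right a
  obtain ⟨c, hc⟩ := Matrix.mem_range_scalar_of_commute_single (M := T) fun i j _ ↦ (h _).symm
  exact ⟨c, hc.symm⟩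

/-- Schur orthogonality for the matrix coefficients of an irreducible representation. -/
theorem sum_trace_smul_inv {F X n : Type*} [Field F] [CharZero F] [Group X] [Fintype X] [Fintype n]
    [DecidableEq n] [Nonempty n] (R : X →* Matrix n n F)
    (hR : Submodule.span F (Set.range R) = ⊤) :
    ∑ x, (R x).trace • R x⁻¹ = Matrix.scalar n ((Fintype.card X : F) / Fintype.card n) := by
  have hn : (Fintype.card n : F) ≠ 0 := Nat.cast_ne_zero.mpr Fintype.card_ne_zero
  have h1 (T : Matrix n n F) : ∑ x, R x * T * R x⁻¹ =
      Matrix.scalar n ((Fintype.card X : F) / Fintype.card n * T.trace) := by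
    obtain ⟨c, hc⟩ := exists_eq_scalar_of_commute R hR (∑ x, R x * T * R x⁻¹) fun y ↦ by
      rw [commute_iff_eq, Finset.sum_mul, Finset.mul_sum,
        ← Equiv.sum_comp (Equiv.mulLeft y)]
      refine Finset.sum_congr rfl fun x _ ↦ ?_
      simp only [Equiv.coe_mulLeft, mul_inv_rev, map_mul, mul_assoc]
      rw [← map_mul R y⁻¹ y, inv_mul_cancel, map_one, mul_one]
    have h2 := congrArg Matrix.trace hc
    rw [Matrix.trace_sum] at h2
    simp_rw [fun x : X ↦ show (R x * T * R x⁻¹).trace = T.trace by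
      rw [Matrix.trace_mul_comm, ← mul_assoc, ← map_mul, inv_mul_cancel, map_one, one_mul]] at h2
    rw [Matrix.scalar_apply, Matrix.trace_diagonal] at h2
    simp only [Finset.sum_const, Finset.card_univ, nsmul_eq_mul] at h2
    rw [hc]
    congr 1
    field_simp
    linear_combination -h2
  ext k l
  have h2 (i : n) := congrFun (congrFun (h1 (Matrix.single i k 1)) i) l
  have h3 : ∑ i, (∑ x, R x * Matrix.single i k 1 * R x⁻¹ : Matrix n n F) i l =
    (∑ x, (R x).trace • R x⁻¹) k l := by
    simp_rw [Matrix.sum_apply]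
    rw [Finset.sum_comm]
    refine Finset.sum_congr rfl fun x _ ↦ ?_
    rw [Matrix.smul_apply, smul_eq_mul, Matrix.trace, Finset.sum_mul]
    refine Finset.sum_congr rfl fun i _ ↦ ?_
    simp [Matrix.mul_apply, Matrix.single_apply, ite_and]
  rw [← h3]
  simp_rw [h2]
  simp [Matrix.scalar_apply, Matrix.diagonal_apply, Matrix.trace,
    Matrix.single_apply, ite_and]

/-- The projection onto the `lam`-isotypic component of a representation of an abelian group. -/
noncomputable def isotypicProjection {F V n : Type*} [Field F] [CommGroup V] [Fintype V]
    [Fintype n] [DecidableEq n] (R : V →* Matrix n n F) (lam : V →* Fˣ) : Matrix n n F :=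
  (Fintype.card V : F)⁻¹ • ∑ u, ((lam u⁻¹ : Fˣ) : F) • R u

theorem sum_smul_isotypicProjection {F V n : Type*} [Field F] [CharZero F] [CommGroup V] [Fintype V]
    [Fintype n] [DecidableEq n] (R : V →* Matrix n n F)
    [IsAlgClosed F] [Fintype (V →* Fˣ)] (u : V) :
    ∑ lam : V →* Fˣ, (lam u : F) • isotypicProjection R lam = R u := by
  classical
  have hV : (Fintype.card V : F) ≠ 0 := Nat.cast_ne_zero.mpr Fintype.card_ne_zero
  simp_rw [isotypicProjection, smul_comm _ (Fintype.card V : F)⁻¹, Finset.smul_sum, smul_smul]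
  rw [Finset.sum_comm]
  have h (w : V) : ∑ lam : V →* Fˣ, ((Fintype.card V : F)⁻¹ * ((lam u : F) * (lam w⁻¹ : Fˣ))) • R w
      = if w = u then R w else 0 := by
    rw [← Finset.sum_smul, ← Finset.mul_sum]
    simp_rw [← Units.val_mul, ← map_mul]
    rw [sum_dual_apply]
    simp only [mul_inv_eq_one, eq_comm (a := u)]
    split_ifs with h
    · rw [inv_mul_cancel₀ hV, one_smul]
    · simp
  simp_rw [h]
  simp

theorem sum_smul_map_inv {F V n : Type*} [Field F] [CharZero F] [CommGroup V] [Fintype V]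
    [Fintype n] [DecidableEq n] (R : V →* Matrix n n F)
    (lam : V →* Fˣ) :
    ∑ u, (lam u : F) • R u⁻¹ = (Fintype.card V : F) • isotypicProjection R lam := by
  have hV : (Fintype.card V : F) ≠ 0 := Nat.cast_ne_zero.mpr Fintype.card_ne_zero
  rw [isotypicProjection, smul_smul, mul_inv_cancel₀ hV, one_smul, ← Equiv.sum_comp (Equiv.inv V)]
  simp

theorem map_mul_isotypicProjection {F V n : Type*} [Field F] [CommGroup V] [Fintype V]
    [Fintype n] [DecidableEq n] (R : V →* Matrix n n F)
    (lam : V →* Fˣ) (u : V) :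
    R u * isotypicProjection R lam = (lam u : F) • isotypicProjection R lam := by
  have h : ∑ w, (lam u : F) • ((lam w⁻¹ : Fˣ) : F) • R w =
      ∑ w, ((lam w⁻¹ : Fˣ) : F) • (R u * R w) := by
    rw [← Equiv.sum_comp (Equiv.mulLeft u)]
    refine Finset.sum_congr rfl fun w _ ↦ ?_
    rw [← map_mul, Equiv.coe_mulLeft, smul_smul, ← Units.val_mul, ← map_mul, mul_inv_rev,
      mul_comm w⁻¹, mul_inv_cancel_left]
  rw [isotypicProjection, Matrix.mul_smul, smul_comm, Finset.mul_sum]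
  simp_rw [Matrix.mul_smul]
  rw [← h, ← Finset.smul_sum]

open scoped Classical in
theorem isotypicProjection_mul {F V n : Type*} [Field F] [CharZero F] [CommGroup V] [Fintype V]
    [Fintype n] [DecidableEq n] (R : V →* Matrix n n F)
    (lam μ : V →* Fˣ) :
    isotypicProjection R lam * isotypicProjection R μ =
      if lam = μ then isotypicProjection R μ else 0 := by
  have hV : (Fintype.card V : F) ≠ 0 := Nat.cast_ne_zero.mpr Fintype.card_ne_zero
  conv_lhs => rw [isotypicProjection]
  rw [Matrix.smul_mul, Finset.sum_mul]
  simp_rw [Matrix.smul_mul, map_mul_isotypicProjection, smul_smul]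
  rw [← Finset.sum_smul, smul_smul]
  have h (u : V) : ((lam u⁻¹ : Fˣ) : F) * (μ u) = ((lam⁻¹ * μ) u : Fˣ) := by simp
  simp_rw [h]
  split_ifs with h1
  · subst h1
    simp [hV]
  · rw [sum_units_hom_eq_zero, mul_zero, zero_smul]
    exact fun h2 ↦ h1 (inv_mul_eq_one.mp h2)


/-- An irreducible matrix representation of a semidirect product `V ⋊ G` with `V` abelian has degree
dividing the order of `G`. -/
theorem card_dvd_of_span_eq_top {F G V n : Type*} [Field F] [CharZero F] [IsAlgClosed F] [Group G]
    [Fintype G] [CommGroup V] [Fintype V] (φ : G →* MulAut V) [Fintype n] [DecidableEq n]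
    [Nonempty n] (R : V ⋊[φ] G →* Matrix n n F) (hR : Submodule.span F (Set.range R) = ⊤) :
    Fintype.card n ∣ Fintype.card G := by
  classical
  have := Fintype.ofFinite (V →* Fˣ)
  have hV : (Fintype.card V : F) ≠ 0 := Nat.cast_ne_zero.mpr Fintype.card_ne_zero
  set RV : V →* Matrix n n F := R.comp SemidirectProduct.inl with hRV
  set RG : G →* Matrix n n F := R.comp SemidirectProduct.inr with hRG
  set E := isotypicProjection RV with hE
  set gen : G × (V →* Fˣ) → Matrix n n F := fun x ↦ RG x.1 * E x.2 with hgen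
  have hcomm (g : G) (u : V) : RV (φ g u) * RG g = RG g * RV u := by
    rw [hRV, hRG, MonoidHom.comp_apply, MonoidHom.comp_apply, MonoidHom.comp_apply, ← map_mul,
      ← map_mul, SemidirectProduct.inl_aut]
    simp
  have hEG (g : G) (lam : V →* Fˣ) : E lam * RG g = RG g * E (lam.comp (φ g).toMonoidHom) := by
    rw [hE, isotypicProjection, isotypicProjection, Matrix.smul_mul, Matrix.mul_smul,
      Finset.sum_mul, Finset.mul_sum, ← Equiv.sum_comp (φ g).toEquiv]
    congr 1
    refine Finset.sum_congr rfl fun u _ ↦ ?_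
    rw [Matrix.smul_mul, Matrix.mul_smul, ← hcomm]
    simp
  set O := integralClosure ℤ F
  set S : Submodule O (Matrix n n F) := Submodule.span O (Set.range gen) with hS
  have hmul (x y : Matrix n n F) (hx : x ∈ S) (hy : y ∈ S) : x * y ∈ S := by
    have h1 : S * S ≤ S := by
      rw [hS, Submodule.span_mul_span, Submodule.span_le]
      rintro _ ⟨_, ⟨⟨g, lam⟩, rfl⟩, _, ⟨⟨g', μ⟩, rfl⟩, rfl⟩
      have h2 : gen (g, lam) * gen (g', μ) =
          if lam.comp (φ g').toMonoidHom = μ then gen (g * g', μ) else 0 := by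
        simp only [hgen]
        rw [mul_assoc, ← mul_assoc (E lam), hEG, mul_assoc (RG g'), hE, isotypicProjection_mul,
          ← mul_assoc, ← map_mul]
        split_ifs <;> simp
      simp only [h2]
      split_ifs
      · exact Submodule.subset_span ⟨_, rfl⟩
      · exact Submodule.zero_mem _
    exact h1 (Submodule.mul_mem_mul hx hy)
  have hone : (1 : Matrix n n F) ∈ S := by
    have h1 := sum_smul_isotypicProjection RV 1
    rw [map_one] at h1
    rw [← h1]
    refine Submodule.sum_mem _ fun lam _ ↦ ?_
    refine Submodule.subset_span ⟨(1, lam), ?_⟩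
    simp [hgen, hE]
  have hfg : (Subalgebra.toSubmodule (S.toSubalgebra hone hmul)).FG :=
    Submodule.fg_span (Set.finite_range gen)
  have hint (x : Matrix n n F) (hx : x ∈ S) : IsIntegral ℤ x :=
    isIntegral_trans (A := O) x (IsIntegral.of_mem_of_fg (S.toSubalgebra hone hmul) hfg x hx)
  have := Fintype.ofEquiv _ (SemidirectProduct.equivProd (φ := φ)).symm
  have key : ∑ x, (R x).trace • R x⁻¹ = (Fintype.card V : F) •
      ∑ g, ∑ lam, (E lam * RG g).trace • gen (g⁻¹, lam) := by
    have h1 (u : V) (g : G) : R ⟨u, g⟩ = RV u * RG g := by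
      rw [SemidirectProduct.mk_eq_inl_mul_inr, map_mul]; rfl
    have h2 (u : V) (g : G) : R (⟨u, g⟩ : V ⋊[φ] G)⁻¹ = RG g⁻¹ * RV u⁻¹ := by
      rw [SemidirectProduct.mk_eq_inl_mul_inr, mul_inv_rev, map_mul, ← map_inv, ← map_inv]; rfl
    have h3 (u : V) (g : G) : (RV u * RG g).trace =
        ∑ lam : V →* Fˣ, (lam u : F) * (E lam * RG g).trace := by
      rw [← sum_smul_isotypicProjection RV u, Finset.sum_mul, Matrix.trace_sum]
      simp_rw [Matrix.smul_mul, Matrix.trace_smul, smul_eq_mul]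
      rfl
    rw [← Equiv.sum_comp SemidirectProduct.equivProd.symm, Fintype.sum_prod_type, Finset.sum_comm,
      Finset.smul_sum]
    refine Finset.sum_congr rfl fun g _ ↦ ?_
    calc ∑ u : V, (R ⟨u, g⟩).trace • R (⟨u, g⟩ : V ⋊[φ] G)⁻¹
        = ∑ u : V, ∑ lam : V →* Fˣ,
            (E lam * RG g).trace • (RG g⁻¹ * ((lam u : F) • RV u⁻¹)) := by
          refine Finset.sum_congr rfl fun u _ ↦ ?_
          rw [h1, h2, h3, Finset.sum_smul]
          refine Finset.sum_congr rfl fun lam _ ↦ ?_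
          rw [Matrix.mul_smul, smul_smul, mul_comm]
      _ = _ := by
          rw [Finset.sum_comm, Finset.smul_sum]
          refine Finset.sum_congr rfl fun lam _ ↦ ?_
          rw [← Finset.smul_sum, ← Finset.mul_sum, sum_smul_map_inv, Matrix.mul_smul, smul_comm]
  have hcard : Fintype.card (V ⋊[φ] G) = Fintype.card V * Fintype.card G := by
    rw [← Nat.card_eq_fintype_card, SemidirectProduct.card, Nat.card_eq_fintype_card,
      Nat.card_eq_fintype_card]
  rw [sum_trace_smul_inv R hR, hcard, Nat.cast_mul, mul_div_assoc, map_mul,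
    Matrix.scalar_apply (_ : F), ← Matrix.smul_eq_diagonal_mul] at key
  have key2 := smul_right_injective _ hV key
  have hmem : Matrix.scalar n ((Fintype.card G : F) / Fintype.card n) ∈ S := by
    rw [key2]
    refine Submodule.sum_mem _ fun g _ ↦ Submodule.sum_mem _ fun lam _ ↦ ?_
    have h1 : IsIntegral ℤ (E lam * RG g).trace := by
      refine Matrix.isIntegral_trace_of_isIntegral (hint _ ?_)
      rw [hEG]
      exact Submodule.subset_span ⟨(g, _), rfl⟩
    exact S.smul_mem (⟨_, h1⟩ : O) (Submodule.subset_span ⟨_, rfl⟩)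
  have hint2 : IsIntegral ℤ ((Fintype.card G : F) / Fintype.card n) :=
    (isIntegral_algebraMap_iff (B := Matrix n n F) (algebraMap F (Matrix n n F)).injective).mp
      (hint _ hmem)
  have hn : (Fintype.card n : ℚ) ≠ 0 := Nat.cast_ne_zero.mpr Fintype.card_ne_zero
  have hint3 : IsIntegral ℤ ((Fintype.card G : ℚ) / Fintype.card n) := by
    refine (isIntegral_algebraMap_iff (B := F) (algebraMap ℚ F).injective).mp ?_
    simpa using hint2
  obtain ⟨z, hz⟩ := IsIntegrallyClosed.isIntegral_iff.mp hint3
  rw [eq_intCast, eq_div_iff hn] at hz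
  rw [← Int.natCast_dvd_natCast]
  exact ⟨z, by rw [mul_comm]; exact_mod_cast hz.symm⟩

/-- A nondegenerate quadratic character on a commutative group. -/
structure QuadraticCharacter (V F : Type*) [CommGroup V] [Field F] where
  /-- The underlying function. -/
  toFun : V → Fˣ
  /-- The associated bilinear form. -/
  form : V →* V →* Fˣ
  map_mul' : ∀ u w, toFun (u * w) = toFun u * toFun w * form u w
  nondegenerate : ∀ u, (∀ w, form u w = 1) → u = 1

namespace QuadraticCharacter

variable {V F : Type*} [CommGroup V] [Field F] (f : QuadraticCharacter V F)

instance : CoeFun (QuadraticCharacter V F) fun _ ↦ V → Fˣ := ⟨toFun⟩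

theorem map_mul (u w : V) : f (u * w) = f u * f w * f.form u w := f.map_mul' u w

theorem map_one : f 1 = 1 := by
  have h := f.map_mul 1 1
  simpa using h

theorem form_comm (u w : V) : f.form u w = f.form w u := by
  have h := f.map_mul u w
  rw [mul_comm u, f.map_mul, mul_comm (f w)] at h
  exact (mul_left_cancel h).symm

theorem pow_card_sq (u : V) : f u ^ (Nat.card V ^ 2) = 1 := by
  have h (n : ℕ) : ∃ k : ℕ, f (u ^ n) = f u ^ n * f.form u u ^ k := by
    induction n with
    | zero => exact ⟨0, by simp [f.map_one]⟩
    | succ n ih =>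
      obtain ⟨k, hk⟩ := ih
      refine ⟨k + n, ?_⟩
      rw [pow_succ u, f.map_mul, hk, pow_succ (f u), pow_add, _root_.map_pow, MonoidHom.pow_apply]
      ac_rfl
  obtain ⟨k, hk⟩ := h (Nat.card V)
  rw [pow_card_eq_one', f.map_one] at hk
  rw [sq, pow_mul, eq_inv_of_mul_eq_one_left hk.symm, inv_pow, ← pow_mul, mul_comm k, pow_mul,
    ← MonoidHom.map_pow, pow_card_eq_one']
  simp

/-- The pointwise inverse of a quadratic character. -/
def inv : QuadraticCharacter V F where
  toFun u := (f u)⁻¹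
  form := f.form⁻¹
  map_mul' u w := by rw [f.map_mul, mul_inv, mul_inv]; rfl
  nondegenerate u h := f.nondegenerate u fun w ↦ by simpa using h w

theorem inv_apply (u : V) : f.inv u = (f u)⁻¹ := rfl

/-- The sum of the values of a quadratic character over a subgroup. -/
noncomputable def gaussSum (D : Subgroup V) : F := ∑ᶠ w : D, (f w : F)

theorem gaussSum_mul_gaussSum_inv [Finite V] [CharZero F] {D : Subgroup V}
    (hD : ∀ t ∈ D, (∀ z ∈ D, f.form t z = 1) → t = 1) :
    f.gaussSum D * f.inv.gaussSum D = Nat.card D := by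
  classical
  have := Fintype.ofFinite D
  rw [gaussSum, gaussSum, finsum_eq_sum_of_fintype, finsum_eq_sum_of_fintype, Finset.sum_mul_sum,
    Finset.sum_comm]
  have h1 (z : D) : ∑ w : D, (f w : F) * (f.inv z : Fˣ) =
      ∑ t : D, (f t : F) * (f.form t z : Fˣ) := by
    rw [← Equiv.sum_comp (Equiv.mulLeft z)]
    refine Finset.sum_congr rfl fun t _ ↦ ?_
    rw [inv_apply, Equiv.coe_mulLeft, Subgroup.coe_mul, f.map_mul, ← Units.val_mul,
      ← Units.val_mul, f.form_comm]
    congr 1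
    rw [mul_comm, mul_assoc, inv_mul_cancel_left]
  simp_rw [h1]
  rw [Finset.sum_comm]
  simp_rw [← Finset.mul_sum]
  have h2 (t : D) : ∑ z : D, (f.form t z : F) = if t = 1 then (Nat.card D : F) else 0 := by
    split_ifs with ht
    · simp [ht]
    · refine sum_units_hom_eq_zero (lam := (f.form t).comp D.subtype) fun h3 ↦ ht ?_
      exact Subtype.ext (hD t t.2 fun z hz ↦ DFunLike.congr_fun h3 ⟨z, hz⟩)
  simp_rw [h2]
  simp [f.map_one]

theorem gaussSum_mul_gaussSum [Finite V] {C D : Subgroup V} (hCD : ∀ c ∈ C, ∀ d ∈ D, f.form c d = 1)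
    (hc : C.IsComplement' D) : f.gaussSum C * f.gaussSum D = f.gaussSum ⊤ := by
  have := Fintype.ofFinite V
  have := Fintype.ofFinite C
  have := Fintype.ofFinite D
  rw [gaussSum, gaussSum, gaussSum, finsum_eq_sum_of_fintype, finsum_eq_sum_of_fintype,
    Finset.sum_mul_sum, ← Fintype.sum_prod_type',
    ← finsum_comp_equiv (Subgroup.topEquiv (G := V)).symm.toEquiv, finsum_eq_sum_of_fintype]
  refine Fintype.sum_bijective (fun x : C × D ↦ (x.1 : V) * x.2) hc _ _ fun x ↦ ?_
  change _ = ((f (x.1 * x.2) : Fˣ) : F)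
  rw [f.map_mul, hCD _ x.1.2 _ x.2.2, mul_one, Units.val_mul]

end QuadraticCharacter

/-- The endomorphism `u ↦ σ u / u` attached to an automorphism `σ`. -/
def displacement {V : Type*} [CommGroup V] (σ : MulAut V) : V →* V := σ.toMonoidHom / MonoidHom.id V

theorem displacement_apply {V : Type*} [CommGroup V] (σ : MulAut V) (u : V) :
    displacement σ u = σ u / u := rfl

theorem mem_ker_displacement {V : Type*} [CommGroup V] {σ : MulAut V} {u : V} :
    u ∈ (displacement σ).ker ↔ σ u = u := by
  rw [MonoidHom.mem_ker, displacement_apply, div_eq_one]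

theorem isComplement_ker_range_displacement {V : Type*} [CommGroup V] [Finite V] {σ : MulAut V}
    (hσ : (orderOf σ).Coprime (Nat.card V)) :
    (displacement σ).ker.IsComplement' (displacement σ).range := by
  refine Subgroup.isComplement'_of_card_mul_and_disjoint ?_ ?_
  · rw [← Subgroup.index_ker, Subgroup.card_mul_index]
  · rw [Subgroup.disjoint_def]
    rintro _ hx ⟨u, rfl⟩
    rw [mem_ker_displacement] at hx
    refine eq_one_of_pow_eq_one_of_coprime (n := orderOf σ) ?_ hσ
    exact pow_orderOf_eq_one_of_smul_eq_mul (MonoidHom.id (MulAut V)) (u := u)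
      (by simp [displacement_apply]) hx

namespace QuadraticCharacter

variable {V F : Type*} [CommGroup V] [Field F] (f : QuadraticCharacter V F) {σ : MulAut V}

theorem form_map_map (hf : ∀ u, f (σ u) = f u) (u w : V) : f.form (σ u) (σ w) = f.form u w := by
  have h := f.map_mul (σ u) (σ w)
  rw [← _root_.map_mul, hf, hf, hf, f.map_mul] at h
  exact (mul_left_cancel h).symm

theorem form_ker_range_displacement (hf : ∀ u, f (σ u) = f u) :
    ∀ c ∈ (displacement σ).ker, ∀ d ∈ (displacement σ).range, f.form c d = 1 := by
  rintro c hc _ ⟨u, rfl⟩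
  rw [mem_ker_displacement] at hc
  rw [displacement_apply, map_div, div_eq_one]
  conv_lhs => rw [← hc]
  exact f.form_map_map hf c u

theorem nondegenerate_range_displacement [Finite V] (hσ : (orderOf σ).Coprime (Nat.card V))
    (hf : ∀ u, f (σ u) = f u) : ∀ t ∈ (displacement σ).range,
      (∀ z ∈ (displacement σ).range, f.form t z = 1) → t = 1 := by
  intro t ht h
  refine f.nondegenerate t fun w ↦ ?_
  obtain ⟨⟨c, d⟩, hcd⟩ := (isComplement_ker_range_displacement hσ).2 w
  dsimp only at hcd
  rw [← hcd, _root_.map_mul, h _ d.2, mul_one, f.form_comm,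
    f.form_ker_range_displacement hf _ c.2 _ ht]

theorem nondegenerate_ker_displacement [Finite V] (hσ : (orderOf σ).Coprime (Nat.card V))
    (hf : ∀ u, f (σ u) = f u) : ∀ t ∈ (displacement σ).ker,
      (∀ z ∈ (displacement σ).ker, f.form t z = 1) → t = 1 := by
  intro t ht h
  refine f.nondegenerate t fun w ↦ ?_
  obtain ⟨⟨c, d⟩, hcd⟩ := (isComplement_ker_range_displacement hσ).2 w
  dsimp only at hcd
  rw [← hcd, _root_.map_mul, h _ c.2, one_mul, f.form_ker_range_displacement hf _ ht _ d.2]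

theorem card_mul_gaussSum_range [Finite V] [CharZero F] (hσ : (orderOf σ).Coprime (Nat.card V))
    (hf : ∀ u, f (σ u) = f u) :
    (Nat.card (displacement σ).ker : F) * f.gaussSum (displacement σ).range =
      f.gaussSum ⊤ * f.inv.gaussSum (displacement σ).ker := by
  rw [← f.gaussSum_mul_gaussSum_inv (f.nondegenerate_ker_displacement hσ hf),
    ← f.gaussSum_mul_gaussSum (f.form_ker_range_displacement hf)
      (isComplement_ker_range_displacement hσ)]
  ring

end QuadraticCharacter

namespace QuadraticCharacter

theorem gaussSum_map {V F : Type*} [CommGroup V] [Field F] (f : QuadraticCharacter V F)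
    {σ : MulAut V} (hf : ∀ u, f (σ u) = f u) (D : Subgroup V) :
    f.gaussSum (D.map (σ : V →* V)) = f.gaussSum D := by
  rw [gaussSum, gaussSum, ← finsum_comp_equiv (σ.subgroupMap D).toEquiv]
  refine finsum_congr fun w ↦ ?_
  exact congrArg Units.val (hf w)

end QuadraticCharacter

theorem range_displacement_conj {V : Type*} [CommGroup V] (σ τ : MulAut V) :
    (displacement (τ⁻¹ * σ * τ)).range =
      (displacement σ).range.map ((τ⁻¹ : MulAut V) : V →* V) := by
  ext w
  constructor
  · rintro ⟨u, rfl⟩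
    refine ⟨_, ⟨τ u, rfl⟩, ?_⟩
    simp [displacement_apply]
  · rintro ⟨_, ⟨u, rfl⟩, rfl⟩
    refine ⟨τ⁻¹ u, ?_⟩
    simp [displacement_apply]

open scoped Classical in
theorem card_filter_mul_mul_inv_eq {G V : Type*} [Group G] [CommGroup V] [Finite V]
    {φ : G →* MulAut V} [Fintype (V ⋊[φ] G)] {v : V} {H : Subgroup G} [Fintype H]
    (hH : ∀ g, g ∈ H ↔ φ g v = v) (h h' : H) (hc : (orderOf (φ h)).Coprime (Nat.card V)) :
    ({y : V ⋊[φ] G | (⟨v, h⟩ : V ⋊[φ] G) * y * (⟨v, h'⟩ : V ⋊[φ] G)⁻¹ = y} : Finset _).card =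
      ({g : H | g⁻¹ * h * g = h'} : Finset H).card * Nat.card (displacement (φ h)).ker := by
  have := Fintype.ofFinite V
  rw [Nat.card_eq_fintype_card, ← Finset.card_univ, ← Finset.card_product]
  have key (u : V) (g : G) : (⟨v, h⟩ : V ⋊[φ] G) * ⟨u, g⟩ * (⟨v, h'⟩ : V ⋊[φ] G)⁻¹ = ⟨u, g⟩ ↔
      g ∈ H ∧ g⁻¹ * h * g = h' ∧ φ h u = u := by
    rw [mul_inv_eq_iff_eq_mul, SemidirectProduct.ext_iff]
    simp only [SemidirectProduct.mul_left, SemidirectProduct.mul_right]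
    constructor
    · rintro ⟨h1, h2⟩
      have e1 : displacement (φ h) u = φ g v / v := by
        rw [displacement_apply, div_eq_div_iff_mul_eq_mul, mul_comm _ v, h1, mul_comm]
      have e2 : φ g v / v ∈ (displacement (φ h)).ker := by
        rw [mem_ker_displacement, map_div, (hH h).mp h.2, ← MulAut.mul_apply, ← map_mul, h2,
          map_mul, MulAut.mul_apply, (hH h').mp h'.2]
      have e3 := (Subgroup.disjoint_def.mp (isComplement_ker_range_displacement hc).disjoint) e2
        ⟨u, e1⟩
      rw [e3, displacement_apply, div_eq_one] at e1
      exact ⟨(hH g).mpr (div_eq_one.mp e3), by rw [mul_assoc, h2, inv_mul_cancel_left], e1⟩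
    · rintro ⟨h1, h2, h3⟩
      exact ⟨by rw [h3, (hH g).mp h1, mul_comm], by rw [← h2]; group⟩
  refine Finset.card_bij' (i := fun y hy ↦ (⟨y.right, ((key _ _).mp (Finset.mem_filter.mp hy).2).1⟩,
    ⟨y.left, mem_ker_displacement.mpr ((key _ _).mp (Finset.mem_filter.mp hy).2).2.2⟩))
    (j := fun z _ ↦ ⟨z.2, z.1⟩) ?_ ?_ ?_ ?_
  · intro y hy
    have := ((key _ _).mp (Finset.mem_filter.mp hy).2).2.1
    simp only [Finset.mem_product, Finset.mem_univ, and_true, Finset.mem_filter, true_and]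
    exact Subtype.ext this
  · rintro ⟨g, u⟩ hz
    simp only [Finset.mem_product, Finset.mem_univ, and_true, Finset.mem_filter, true_and] at hz ⊢
    rw [key]
    exact ⟨g.2, congrArg Subtype.val hz, mem_ker_displacement.mp u.2⟩
  · intro y hy
    rfl
  · intro z hz
    rfl

open scoped Classical in
/-- The averages over the cosets `v H` of characters against Gauss sums are orthonormal up to the
factor `|V|`. -/
theorem sum_average_mul_average_eq_card {F G V ι : Type*} [Field F] [CharZero F] [Group G]
    [CommGroup V] [Finite V] {φ : G →* MulAut V} [Fintype (V ⋊[φ] G)] {v : V} {H : Subgroup G}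
    [Fintype H] (hH : ∀ g, g ∈ H ↔ φ g v = v) (hc : (Nat.card G).Coprime (Nat.card V))
    (f : QuadraticCharacter V F) (hf : ∀ h ∈ H, ∀ u, f (φ h u) = f u) [Fintype ι]
    (χ : ι → V ⋊[φ] G → F) (hχ : ∀ a b, ∑ i, χ i a * χ i b =
      ({y : V ⋊[φ] G | a * y * b = y} : Finset (V ⋊[φ] G)).card) :
    ∑ i, ((Fintype.card H : F)⁻¹ * ∑ h : H, χ i ⟨v, h⟩ * f.gaussSum (displacement (φ h)).range) *
      ((Fintype.card H : F)⁻¹ * ∑ h : H, χ i (⟨v, h⟩ : V ⋊[φ] G)⁻¹ *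
        f.inv.gaussSum (displacement (φ h)).range) = Nat.card V := by
  have hH0 : (Fintype.card H : F) ≠ 0 := Nat.cast_ne_zero.mpr Fintype.card_ne_zero
  have hc' (h : G) : (orderOf (φ h)).Coprime (Nat.card V) :=
    hc.coprime_dvd_left ((orderOf_map_dvd φ h).trans (orderOf_dvd_natCard h))
  have hfi (h) (hh : h ∈ H) (u) : f.inv (φ h u) = f.inv u := by
    rw [f.inv_apply, f.inv_apply, hf h hh]
  set Ψ : H → F := fun h ↦ f.gaussSum (displacement (φ h)).range with hΨ
  set Ψ' : H → F := fun h ↦ f.inv.gaussSum (displacement (φ h)).range with hΨ'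
  have hconj (g h : H) : Ψ' (g⁻¹ * h * g) = Ψ' h := by
    simp only [hΨ', Subgroup.coe_mul, Subgroup.coe_inv, map_mul, map_inv]
    rw [range_displacement_conj, QuadraticCharacter.gaussSum_map]
    rw [← map_inv]
    exact hfi _ (H.inv_mem g.2)
  have h1 (h : H) : Ψ h * Ψ' h * Nat.card (displacement (φ h)).ker = Nat.card V := by
    rw [hΨ, hΨ', f.gaussSum_mul_gaussSum_inv (f.nondegenerate_range_displacement (hc' h)
      (hf h h.2)), ← Subgroup.index_ker, mul_comm, ← Nat.cast_mul, Subgroup.card_mul_index]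
  have h2 : ∑ i, (∑ h : H, χ i ⟨v, h⟩ * Ψ h) * (∑ h : H, χ i (⟨v, h⟩ : V ⋊[φ] G)⁻¹ * Ψ' h) =
      ∑ h : H, ∑ h' : H, Ψ h * Ψ' h' *
        ∑ i, χ i ⟨v, h⟩ * χ i (⟨v, h'⟩ : V ⋊[φ] G)⁻¹ := by
    simp_rw [Finset.sum_mul_sum]
    rw [Finset.sum_comm]
    refine Finset.sum_congr rfl fun h _ ↦ ?_
    rw [Finset.sum_comm]
    refine Finset.sum_congr rfl fun h' _ ↦ ?_
    rw [Finset.mul_sum]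
    exact Finset.sum_congr rfl fun i _ ↦ by ring
  have h3 (h : H) : ∑ h' : H, Ψ h * Ψ' h' * ∑ i, χ i ⟨v, h⟩ * χ i (⟨v, h'⟩ : V ⋊[φ] G)⁻¹ =
      Fintype.card H * Nat.card V := by
    simp_rw [hχ, card_filter_mul_mul_inv_eq hH _ _ (hc' _), Finset.card_filter]
    push_cast
    calc ∑ h' : H, Ψ h * Ψ' h' * ((∑ g : H, if g⁻¹ * h * g = h' then (1 : F) else 0) *
            Nat.card (displacement (φ h)).ker)
        = ∑ h' : H, ∑ g : H, if g⁻¹ * h * g = h' then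
            Ψ h * Ψ' h' * Nat.card (displacement (φ h)).ker else 0 := by
          refine Finset.sum_congr rfl fun h' _ ↦ ?_
          rw [Finset.sum_mul, Finset.mul_sum]
          exact Finset.sum_congr rfl fun g _ ↦ by split_ifs <;> ring
      _ = ∑ g : H, Ψ h * Ψ' (g⁻¹ * h * g) * Nat.card (displacement (φ h)).ker := by
          rw [Finset.sum_comm]
          simp
      _ = _ := by
          simp_rw [hconj, h1]
          simp
  calc _ = (Fintype.card H : F)⁻¹ * (Fintype.card H : F)⁻¹ *
        ∑ i, (∑ h : H, χ i ⟨v, h⟩ * Ψ h) * (∑ h : H, χ i (⟨v, h⟩ : V ⋊[φ] G)⁻¹ * Ψ' h) := by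
        rw [Finset.mul_sum]
        exact Finset.sum_congr rfl fun i _ ↦ by ring
    _ = _ := by
        rw [h2, Finset.sum_congr rfl fun h _ ↦ h3 h]
        simp only [Finset.sum_const, Finset.card_univ, nsmul_eq_mul]
        field_simp

theorem isIntegral_of_pow_eq_one {A : Type*} [Ring A] {x : A} {m : ℕ} (hm : 0 < m)
    (h : x ^ m = 1) : IsIntegral ℤ x :=
  IsIntegral.of_pow hm (h ▸ isIntegral_one)

theorem isIntegral_trace_map {F X n : Type*} [Field F] [IsAlgClosed F] [Group X] [Finite X]
    [Fintype n] [DecidableEq n] (R : X →* Matrix n n F) (x : X) : IsIntegral ℤ (R x).trace := by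
  refine Matrix.isIntegral_trace_of_isIntegral (isIntegral_of_pow_eq_one (orderOf_pos x) ?_)
  rw [← map_pow, pow_orderOf_eq_one, map_one]

theorem QuadraticCharacter.pow_card_sq_coe {V F : Type*} [CommGroup V] [Field F]
    (f : QuadraticCharacter V F) (u : V) : (f u : F) ^ (Nat.card V ^ 2) = 1 := by
  rw [← Units.val_pow_eq_pow_val, f.pow_card_sq, Units.val_one]

theorem QuadraticCharacter.isIntegral_gaussSum {V F : Type*} [CommGroup V] [Finite V] [Field F]
    (f : QuadraticCharacter V F) (D : Subgroup V) : IsIntegral ℤ (f.gaussSum D) := by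
  have := Fintype.ofFinite D
  rw [gaussSum, finsum_eq_sum_of_fintype]
  exact IsIntegral.sum _ fun u _ ↦
    isIntegral_of_pow_eq_one (pow_pos Nat.card_pos 2) (f.pow_card_sq_coe u)

/-- The average of a character over the coset `v H` against the Gauss sums attached to the elements
of `H`. -/
noncomputable def gaussAverage {F G V : Type*} [Field F] [Group G] [CommGroup V]
    {φ : G →* MulAut V} (χ : V ⋊[φ] G → F) (f : QuadraticCharacter V F) (v : V) (H : Subgroup G)
    [Fintype H] : F :=
  (Fintype.card H : F)⁻¹ * ∑ h : H, χ ⟨v, h⟩ * f.gaussSum (displacement (φ h)).range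

/-- An integral polynomial which inverts all divisors of `N`, up to a factor prime to everything
that is prime to `N`. -/
theorem exists_polynomial_mul_eval_eq {N : ℕ} (hN : N ≠ 0) (k : ℕ) (hk : k.Coprime N) :
    ∃ (Q : Polynomial ℤ) (c : ℤ), IsCoprime (k : ℤ) c ∧
      ∀ s : ℕ, s ∣ N → (s : ℤ) * Q.eval (s : ℤ) = c := by
  set P : Polynomial ℤ := ∏ s ∈ N.divisors, (Polynomial.X - Polynomial.C (s : ℤ)) with hP
  obtain ⟨Q, hQ⟩ : Polynomial.X ∣ P - Polynomial.C (P.eval 0) := by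
    rw [Polynomial.X_dvd_iff]
    simp [Polynomial.coeff_zero_eq_eval_zero]
  refine ⟨-Q, P.eval 0, ?_, fun s hs ↦ ?_⟩
  · rw [hP, Polynomial.eval_prod]
    refine IsCoprime.prod_right fun s hs ↦ ?_
    simp only [Polynomial.eval_sub, Polynomial.eval_X, Polynomial.eval_C, zero_sub]
    rw [IsCoprime.neg_right_iff, Nat.isCoprime_iff_coprime]
    exact hk.coprime_dvd_right (Nat.dvd_of_mem_divisors hs)
  · have h1 := congrArg (Polynomial.eval (s : ℤ)) hQ
    have h2 : P.eval (s : ℤ) = 0 := by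
      rw [hP, Polynomial.eval_prod]
      exact Finset.prod_eq_zero (Nat.mem_divisors.mpr ⟨hs, hN⟩) (by simp)
    simp only [Polynomial.eval_sub, Polynomial.eval_C, Polynomial.eval_mul, Polynomial.eval_X, h2,
      zero_sub] at h1
    rw [Polynomial.eval_neg, mul_neg, ← h1, neg_neg]

open scoped Classical in
theorem gaussSum_ker_eq_sum {F V : Type*} [Field F] [CommGroup V] [Fintype V]
    (f : QuadraticCharacter V F) (σ : MulAut V) :
    f.gaussSum (displacement σ).ker = ∑ u with σ u = u, (f u : F) := by
  rw [QuadraticCharacter.gaussSum, finsum_eq_sum_of_fintype]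
  refine (Finset.sum_subtype _ (fun u ↦ ?_) (fun u ↦ (f u : F))).symm
  rw [Finset.mem_filter, mem_ker_displacement]
  simp

theorem isIntegral_gaussAverage {F G V n : Type*} [Field F] [CharZero F] [IsAlgClosed F] [Group G]
    [Finite G] [CommGroup V] [Finite V] {φ : G →* MulAut V} [Fintype n] [DecidableEq n]
    (R : V ⋊[φ] G →* Matrix n n F) {v : V} {H : Subgroup G}
    [Fintype H] (hH : ∀ h ∈ H, φ h v = v) (hc : (Nat.card G).Coprime (Nat.card V))
    (f : QuadraticCharacter V F) (hf : ∀ h ∈ H, ∀ u, f (φ h u) = f u) :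
    IsIntegral ℤ (gaussAverage (fun x ↦ (R x).trace) f v H) := by
  classical
  have := Fintype.ofFinite V
  have : Finite (V ⋊[φ] G) := Finite.of_equiv _ SemidirectProduct.equivProd.symm
  have hH0 : (Fintype.card H : F) ≠ 0 := Nat.cast_ne_zero.mpr Fintype.card_ne_zero
  have hc' (h : G) : (orderOf (φ h)).Coprime (Nat.card V) :=
    hc.coprime_dvd_left ((orderOf_map_dvd φ h).trans (orderOf_dvd_natCard h))
  have hcH : (Fintype.card H).Coprime (Nat.card V) := by
    rw [← Nat.card_eq_fintype_card]
    exact hc.coprime_dvd_left H.card_subgroup_dvd_card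
  obtain ⟨Q, c, ⟨a, b, hab⟩, hQ⟩ := exists_polynomial_mul_eval_eq (N := Nat.card V)
    Nat.card_pos.ne' _ hcH
  set m := gaussAverage (fun x ↦ (R x).trace) f v H with hm
  have t1 : IsTraceFunction (fun h : H ↦ (R ⟨v, h⟩).trace) := by
    refine IsTraceFunction.of_matrix (R.comp (SemidirectProduct.inr.comp H.subtype))
      (R (SemidirectProduct.inl v)) (orderOf_pos v) ?_ (fun h ↦ ?_) (fun h ↦ ?_)
    · rw [← map_pow, ← map_pow, pow_orderOf_eq_one, map_one, map_one]
    · refine Commute.map (x := SemidirectProduct.inl v)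
        (y := (SemidirectProduct.inr (h : G) : V ⋊[φ] G)) ?_ R
      rw [commute_iff_eq]
      ext <;> simp [hH h h.2]
    · rw [SemidirectProduct.mk_eq_inl_mul_inr, map_mul, Matrix.trace_mul_comm]
      rfl
  have t2 : IsTraceFunction (fun h : H ↦ f.inv.gaussSum (displacement (φ h)).ker) := by
    simp_rw [gaussSum_ker_eq_sum]
    refine IsTraceFunction.sum_fixedPoints ((MulAut.toPerm V).comp (φ.comp H.subtype))
      (fun u ↦ (f.inv u : F)) (pow_pos Nat.card_pos 2) (fun u ↦ f.inv.pow_card_sq_coe u)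
      (fun h u ↦ ?_)
    rw [f.inv_apply, f.inv_apply]
    exact congrArg (fun x : Fˣ ↦ ((x⁻¹ : Fˣ) : F)) (hf h h.2 u)
  have t3 : IsTraceFunction (fun h : H ↦ (Nat.card (displacement (φ h)).ker : F)) := by
    convert IsTraceFunction.sum_fixedPoints ((MulAut.toPerm V).comp (φ.comp H.subtype))
      (fun u ↦ (1 : F)) one_pos (fun u ↦ one_pow 1) (fun h u ↦ rfl) using 2 with h
    rw [Finset.sum_const, nsmul_eq_mul, mul_one, Nat.card_eq_fintype_card]
    congr 1
    refine Fintype.card_of_subtype _ fun u ↦ ?_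
    rw [Finset.mem_filter, mem_ker_displacement]
    exact ⟨fun h ↦ h.2, fun h ↦ ⟨Finset.mem_univ _, h⟩⟩
  have i1 : IsIntegral ℤ ((Fintype.card H : F) * m) := by
    rw [hm, gaussAverage, ← mul_assoc, mul_inv_cancel₀ hH0, one_mul]
    exact IsIntegral.sum _ fun h _ ↦ (isIntegral_trace_map R _).mul (f.isIntegral_gaussSum _)
  have i2 : IsIntegral ℤ ((c : F) * m) := by
    have e1 (h : H) : (c : F) * f.gaussSum (displacement (φ h)).range = f.gaussSum ⊤ *
        ∑ k ∈ Finset.range (Q.natDegree + 1), (Q.coeff k : F) *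
        (f.inv.gaussSum (displacement (φ h)).ker *
        (Nat.card (displacement (φ h)).ker : F) ^ k) := by
      have h1 := f.card_mul_gaussSum_range (hc' h) (hf h h.2)
      have h2 := hQ _ (displacement (φ h)).ker.card_subgroup_dvd_card
      rw [Polynomial.eval_eq_sum_range] at h2
      rw [← h2]
      push_cast
      rw [mul_right_comm, h1, mul_assoc, Finset.mul_sum]
      congr 1
      exact Finset.sum_congr rfl fun k _ ↦ by ring
    have e2 : (c : F) * m = f.gaussSum ⊤ * ∑ k ∈ Finset.range (Q.natDegree + 1), (Q.coeff k : F) *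
        ((Fintype.card H : F)⁻¹ * ∑ h : H, (R ⟨v, h⟩).trace *
        (f.inv.gaussSum (displacement (φ h)).ker *
        (Nat.card (displacement (φ h)).ker : F) ^ k)) := by
      calc (c : F) * m = (Fintype.card H : F)⁻¹ * ∑ h : H, (R ⟨v, h⟩).trace *
            (c * f.gaussSum (displacement (φ h)).range) := by
            rw [hm, gaussAverage, mul_left_comm, Finset.mul_sum]
            congr 1
            exact Finset.sum_congr rfl fun k _ ↦ by ring
        _ = _ := by
            simp_rw [e1, Finset.mul_sum]
            rw [Finset.sum_comm]
            exact Finset.sum_congr rfl fun k _ ↦ Finset.sum_congr rfl fun h _ ↦ by ring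
    rw [e2]
    refine (f.isIntegral_gaussSum _).mul (IsIntegral.sum _ fun k _ ↦ ?_)
    exact (isIntegral_algebraMap (R := ℤ) (A := F)).mul
      (t1.mul (t2.mul (t3.pow k))).isIntegral_average
  have e : m = a * (Fintype.card H * m) + b * (c * m) := by
    have h1 : (a : F) * Fintype.card H + b * c = 1 := by
      exact_mod_cast congrArg (Int.cast : ℤ → F) hab
    linear_combination (-m) * h1
  rw [e]
  exact ((isIntegral_algebraMap (R := ℤ) (A := F)).mul i1).add
    ((isIntegral_algebraMap (R := ℤ) (A := F)).mul i2)

theorem exists_ringHom_integralClosure_charP.{u} (F : Type u) [Field F] [CharZero F] (p : ℕ)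
    [hp : Fact p.Prime] : ∃ (k : Type u) (_ : Field k) (_ : CharP k p),
      Nonempty (integralClosure ℤ F →+* k) := by
  have hu : ¬ IsUnit (p : integralClosure ℤ F) := by
    intro h
    obtain ⟨y, hy⟩ := h.exists_right_inv
    have h1 : IsIntegral ℤ (algebraMap ℚ F (p : ℚ)⁻¹) := by
      have h2 : (p : F) * y = 1 := by exact_mod_cast congrArg Subtype.val hy
      have h3 : algebraMap ℚ F (p : ℚ)⁻¹ = y := by
        rw [map_inv₀, map_natCast]
        exact (eq_inv_of_mul_eq_one_right h2).symm
      rw [h3]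
      exact y.2
    rw [isIntegral_algebraMap_iff (algebraMap ℚ F).injective] at h1
    obtain ⟨n, hn⟩ := IsIntegrallyClosed.isIntegral_iff.mp h1
    have h4 : (p : ℤ) * n = 1 := by
      have h5 : (p : ℚ) ≠ 0 := Nat.cast_ne_zero.mpr hp.out.ne_zero
      have h6 : (p : ℚ) * n = 1 := by
        rw [show (n : ℚ) = (p : ℚ)⁻¹ from hn, mul_inv_cancel₀ h5]
      exact_mod_cast h6
    have h7 := Int.isUnit_iff.mp (IsUnit.of_mul_eq_one _ h4)
    have := hp.out.two_le
    omega
  obtain ⟨M, hM, hpM⟩ := exists_max_ideal_of_mem_nonunits hu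
  let := Ideal.Quotient.field M
  refine ⟨integralClosure ℤ F ⧸ M, inferInstance, ?_, ⟨Ideal.Quotient.mk M⟩⟩
  have h0 : (p : integralClosure ℤ F ⧸ M) = 0 := by
    rw [← map_natCast (Ideal.Quotient.mk M)]
    exact Ideal.Quotient.eq_zero_iff_mem.mpr hpM
  exact (CharP.charP_iff_prime_eq_zero hp.out).mpr h0

theorem exists_integralClosure_eq_sum {F k : Type*} [Field F] [Field k] {p : ℕ} [Fact p.Prime]
    [CharP k p] (θ : integralClosure ℤ F →+* k) {N : ℕ} (s : Multiset F)
    (hs : ∀ r ∈ s, r ^ p ^ N = 1) :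
    ∃ y : integralClosure ℤ F, (y : F) = s.sum ∧ θ y = s.card := by
  induction s using Multiset.induction_on with
  | empty => exact ⟨0, by simp⟩
  | cons a s ih =>
    obtain ⟨y, hy, hy'⟩ := ih fun r hr ↦ hs r (Multiset.mem_cons_of_mem hr)
    have ha := hs a (Multiset.mem_cons_self a s)
    set b : integralClosure ℤ F :=
      ⟨a, isIntegral_of_pow_eq_one (pow_pos (Fact.out : p.Prime).pos N) ha⟩ with hb
    have hb' : θ b = 1 := by
      have h1 : b ^ p ^ N = 1 := Subtype.ext ha
      have h2 : (θ b - 1) ^ p ^ N = 0 := by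
        rw [sub_pow_char_pow, ← map_pow, h1, map_one, one_pow, sub_self]
      exact sub_eq_zero.mp (eq_zero_of_pow_eq_zero h2)
    refine ⟨b + y, ?_, ?_⟩
    · rw [Multiset.sum_cons, ← hy]
      rfl
    · rw [map_add, hb', hy', Multiset.card_cons, add_comm]
      push_cast
      rfl

theorem exists_integralClosure_eq_trace {F k n : Type*} [Field F] [IsAlgClosed F] [Field k] {p : ℕ}
    [Fact p.Prime] [CharP k p] (θ : integralClosure ℤ F →+* k) [Fintype n] [DecidableEq n]
    {M : Matrix n n F} {N : ℕ} (hM : M ^ p ^ N = 1) :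
    ∃ y : integralClosure ℤ F, (y : F) = M.trace ∧ θ y = Fintype.card n := by
  have hsplit : M.charpoly.Splits := IsAlgClosed.splits _
  rw [Matrix.trace_eq_sum_roots_charpoly_of_splits hsplit]
  rw [← M.charpoly_natDegree_eq_dim, hsplit.natDegree_eq_card_roots]
  refine exists_integralClosure_eq_sum θ (N := N) _ fun r hr ↦ ?_
  have h1 : r ∈ spectrum F M := by
    rw [Matrix.mem_spectrum_iff_isRoot_charpoly]
    exact Polynomial.isRoot_of_mem_roots hr
  have h2 := spectrum.pow_mem_pow M (p ^ N) h1
  rw [hM] at h2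
  cases isEmpty_or_nonempty n
  · rw [spectrum.of_subsingleton] at h2
    exact h2.elim
  · rwa [spectrum.one_eq, Set.mem_singleton_iff] at h2

theorem QuadraticCharacter.exists_integralClosure_eq_gaussSum {V F k : Type*} [CommGroup V]
    [Finite V] [Field F] [Field k] {p : ℕ} [Fact p.Prime] [CharP k p]
    (θ : integralClosure ℤ F →+* k) (hV : IsPGroup p V) (f : QuadraticCharacter V F)
    (D : Subgroup V) : ∃ y : integralClosure ℤ F, (y : F) = f.gaussSum D ∧ θ y = Nat.card D := by
  have := Fintype.ofFinite D
  obtain ⟨N, hN⟩ := IsPGroup.iff_card.mp hV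
  rw [gaussSum, finsum_eq_sum_of_fintype, Nat.card_eq_fintype_card, ← Finset.card_univ]
  obtain ⟨y, h1, h2⟩ := exists_integralClosure_eq_sum θ (N := N * 2)
    (Finset.univ.val.map fun u : D ↦ (f u : F)) (by
      intro r hr
      obtain ⟨u, -, rfl⟩ := Multiset.mem_map.mp hr
      rw [pow_mul, ← hN]
      exact f.pow_card_sq_coe _)
  exact ⟨y, h1, by rw [h2, Multiset.card_map]; rfl⟩

theorem gaussAverage_ne_zero {F G V n : Type*} [Field F] [CharZero F] [IsAlgClosed F] [Group G]
    [Finite G] [CommGroup V] [Finite V] {φ : G →* MulAut V} (hφ : Function.Injective φ)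
    [Fintype n] [DecidableEq n] [Nonempty n]
    (R : V ⋊[φ] G →* Matrix n n F) (hR : Submodule.span F (Set.range R) = ⊤) {v : V}
    {H : Subgroup G} [Fintype H] {p : ℕ} [hp : Fact p.Prime] (hV : IsPGroup p V)
    (hpG : p.Coprime (Nat.card G)) (f : QuadraticCharacter V F) :
    gaussAverage (fun x ↦ (R x).trace) f v H ≠ 0 := by
  classical
  have := Fintype.ofFinite V
  have := Fintype.ofFinite G
  have : Finite (V ⋊[φ] G) := Finite.of_equiv _ SemidirectProduct.equivProd.symm
  obtain ⟨k, _, _, ⟨θ⟩⟩ := exists_ringHom_integralClosure_charP F p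
  intro h0
  rw [gaussAverage, mul_eq_zero, inv_eq_zero, or_iff_right
    (Nat.cast_ne_zero.mpr Fintype.card_ne_zero)] at h0
  choose Y hY hY' using fun D ↦ f.exists_integralClosure_eq_gaussSum θ hV D
  obtain ⟨N, hN⟩ := IsPGroup.iff_card.mp hV
  obtain ⟨y, hy, hy'⟩ := exists_integralClosure_eq_trace θ (M := R (SemidirectProduct.inl v))
    (N := N) (by rw [← map_pow, ← map_pow, ← hN, pow_card_eq_one', map_one, map_one])
  set X : H → integralClosure ℤ F := fun h ↦ ⟨_, isIntegral_trace_map R ⟨v, h⟩⟩ with hX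
  have h1 : ∑ h : H, X h * Y (displacement (φ h)).range = 0 := by
    refine Subtype.ext ?_
    rw [AddSubmonoidClass.coe_finsetSum]
    refine Eq.trans (Finset.sum_congr rfl fun h _ ↦ ?_) h0
    rw [MulMemClass.coe_mul, hY]
  have h2 := congrArg θ h1
  rw [map_sum, map_zero, Finset.sum_eq_single 1] at h2
  · have h3 : (displacement (φ ((1 : H) : G))).range = ⊥ := by
      rw [eq_bot_iff]
      rintro _ ⟨u, rfl⟩
      simp [displacement_apply]
    have h4 : X 1 = y := Subtype.ext hy.symm
    rw [map_mul, hY', h3, h4, hy'] at h2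
    simp only [Nat.card_eq_fintype_card, Fintype.card_unique, Nat.cast_one, mul_one] at h2
    rw [CharP.cast_eq_zero_iff k p] at h2
    have h5 := h2.trans (card_dvd_of_span_eq_top φ R hR)
    rw [← Nat.card_eq_fintype_card] at h5
    exact hp.out.one_lt.ne' (Nat.eq_one_of_dvd_coprimes hpG dvd_rfl h5)
  · intro h _ hh
    rw [map_mul, hY']
    obtain ⟨m, hm⟩ := IsPGroup.iff_card.mp (hV.to_subgroup (displacement (φ h)).range)
    have hm0 : m ≠ 0 := by
      rintro rfl
      rw [pow_zero, Subgroup.card_eq_one] at hm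
      refine hh (Subtype.ext (hφ ?_))
      rw [Subgroup.coe_one, map_one]
      ext u
      have h3 : displacement (φ h) u = 1 := by
        rw [← Subgroup.mem_bot, ← hm]
        exact ⟨u, rfl⟩
      rwa [displacement_apply, div_eq_one] at h3
    rw [hm, Nat.cast_pow, CharP.cast_eq_zero, zero_pow hm0, mul_zero]
  · simp

theorem range_displacement_inv {V : Type*} [CommGroup V] (σ : MulAut V) :
    (displacement σ⁻¹).range = (displacement σ).range := by
  have h (τ : MulAut V) : (displacement τ⁻¹).range ≤ (displacement τ).range := by
    rintro _ ⟨u, rfl⟩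
    refine ⟨(τ⁻¹ u)⁻¹, ?_⟩
    simp [displacement_apply, div_eq_mul_inv, mul_comm]
  refine le_antisymm (h σ) ?_
  simpa using h σ⁻¹

theorem gaussAverage_inv {F G V : Type*} [Field F] [Group G] [CommGroup V]
    {φ : G →* MulAut V} (χ : V ⋊[φ] G → F) (f : QuadraticCharacter V F) {v : V} {H : Subgroup G}
    [Fintype H] (hH : ∀ h ∈ H, φ h v = v) :
    gaussAverage χ f v⁻¹ H = (Fintype.card H : F)⁻¹ *
      ∑ h : H, χ (⟨v, h⟩ : V ⋊[φ] G)⁻¹ * f.gaussSum (displacement (φ h)).range := by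
  rw [gaussAverage, ← Equiv.sum_comp (Equiv.inv H)]
  congr 1
  refine Finset.sum_congr rfl fun h _ ↦ ?_
  have h1 : (⟨v, h⟩ : V ⋊[φ] G)⁻¹ = ⟨v⁻¹, (h⁻¹ : H)⟩ := by
    ext
    · have h2 : φ (h : G)⁻¹ v = v := hH _ (H.inv_mem h.2)
      rw [SemidirectProduct.inv_left, map_inv, h2]
    · simp
  rw [h1, Equiv.inv_apply, Subgroup.coe_inv, map_inv, range_displacement_inv]

theorem QuadraticCharacter.map_gaussSum_inv {F V : Type*} [Field F] [CommGroup V] [Finite V]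
    (f : QuadraticCharacter V F) (D : Subgroup V) (τ : F →+* ℂ) :
    τ (f.inv.gaussSum D) = star (τ (f.gaussSum D)) := by
  have := Fintype.ofFinite D
  rw [gaussSum, gaussSum, finsum_eq_sum_of_fintype, finsum_eq_sum_of_fintype, map_sum, map_sum,
    star_sum]
  refine Finset.sum_congr rfl fun u _ ↦ ?_
  rw [inv_apply, Units.val_inv_eq_inv_val, map_inv₀]
  refine Complex.inv_eq_conj (Complex.norm_eq_one_of_pow_eq_one (n := Nat.card V ^ 2) ?_
    (pow_ne_zero 2 Nat.card_pos.ne'))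
  rw [← _root_.map_pow, f.pow_card_sq_coe, _root_.map_one]

theorem map_gaussAverage_inv {F G V n : Type*} [Field F] [CharZero F] [Group G]
    [Finite G] [CommGroup V] [Finite V] {φ : G →* MulAut V} [Fintype n] [DecidableEq n]
    (R : V ⋊[φ] G →* Matrix n n F) {v : V} {H : Subgroup G}
    [Fintype H] (hH : ∀ h ∈ H, φ h v = v) (f : QuadraticCharacter V F) (τ : F →+* ℂ) :
    τ (gaussAverage (fun x ↦ (R x).trace) f.inv v⁻¹ H) =
      star (τ (gaussAverage (fun x ↦ (R x).trace) f v H)) := by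
  have : Finite (V ⋊[φ] G) := Finite.of_equiv _ SemidirectProduct.equivProd.symm
  have h1 (M : Matrix n n F) : τ M.trace = (τ.mapMatrix M).trace := by
    simp [Matrix.trace]
  have h2 (x : V ⋊[φ] G) : τ (R x⁻¹).trace = star (τ (R x).trace) := by
    rw [h1, h1]
    exact trace_map_inv_eq_conj ((τ.mapMatrix (m := n)).toMonoidHom.comp R) x
  rw [gaussAverage_inv _ _ hH, gaussAverage]
  simp only [map_mul, map_inv₀, map_natCast, map_sum, star_mul', star_inv₀, star_natCast,
    star_sum, h2, f.map_gaussSum_inv]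

/-- If the stabilizer of some vector preserves a nondegenerate quadratic character, then the
semidirect product has at most `|V|` conjugacy classes. -/
theorem card_conjClasses_le_of_quadraticCharacter {F G V : Type*} [Field F] [CharZero F]
    [IsAlgClosed F] [Algebra.IsAlgebraic ℚ F] [Group G] [Finite G] [CommGroup V] [Finite V]
    {φ : G →* MulAut V} (hφ : Function.Injective φ) {p : ℕ} [hp : Fact p.Prime]
    (hV : IsPGroup p V) (hc : (Nat.card G).Coprime (Nat.card V)) (hpG : p.Coprime (Nat.card G))
    (v : V) (f : QuadraticCharacter V F) (hf : ∀ g, φ g v = v → ∀ u, f (φ g u) = f u) :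
    Nat.card (ConjClasses (V ⋊[φ] G)) ≤ Nat.card V := by
  classical
  have : Finite (V ⋊[φ] G) := Finite.of_equiv _ SemidirectProduct.equivProd.symm
  have := Fintype.ofFinite (V ⋊[φ] G)
  let H : Subgroup G :=
    { carrier := {g | φ g v = v}
      mul_mem' := fun {a b} (ha : φ a v = v) (hb : φ b v = v) ↦
        show φ (a * b) v = v by rw [map_mul, MulAut.mul_apply, hb, ha]
      one_mem' := show φ 1 v = v by rw [map_one, MulAut.one_apply]
      inv_mem' := fun {a} (ha : φ a v = v) ↦
        show φ a⁻¹ v = v by rw [map_inv]; nth_rw 1 [← ha]; exact MulAut.inv_apply_self V _ _ }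
  have hH (g : G) : g ∈ H ↔ φ g v = v := Iff.rfl
  have := Fintype.ofFinite H
  obtain ⟨m, d, ρ, hd, hspan, hρ⟩ := exists_matrix_representations F (V ⋊[φ] G)
  have h1 := card_conjClasses_le_of_sum_trace (fun i x ↦ (ρ i x).trace) hρ
  refine h1.trans (card_le_of_sum_totallyPositive
    (fun i ↦ gaussAverage (fun x ↦ (ρ i x).trace) f v H *
      gaussAverage (fun x ↦ (ρ i x).trace) f.inv v⁻¹ H) (fun i ↦ ?_) (fun τ i ↦ ?_) ?_)
  · refine (isIntegral_gaussAverage (ρ i) (fun h hh ↦ hh) hc f hf).mul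
      (isIntegral_gaussAverage (ρ i) (fun h hh ↦ ?_) hc f.inv fun h hh u ↦ ?_)
    · rw [map_inv, (hH h).mp hh]
    · rw [f.inv_apply, f.inv_apply, hf h hh]
  · have : Nonempty (Fin (d i)) := ⟨⟨0, Nat.pos_of_ne_zero (hd i)⟩⟩
    refine ⟨Complex.normSq (τ (gaussAverage (fun x ↦ (ρ i x).trace) f v H)), ?_, ?_⟩
    · rw [Complex.normSq_pos]
      exact (map_ne_zero τ).mpr (gaussAverage_ne_zero hφ (ρ i) (hspan i) hV hpG f)
    · rw [map_mul, map_gaussAverage_inv (ρ i) (fun h hh ↦ hh) f τ]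
      exact Complex.mul_conj _
  · rw [← sum_average_mul_average_eq_card hH hc f hf
      (fun i x ↦ (ρ i x).trace) (fun a b ↦ by convert hρ a b)]
    exact Finset.sum_congr rfl fun i _ ↦ by
      rw [gaussAverage_inv _ _ (fun h hh ↦ hh)]; rfl

/-- Some vector has a stabilizer that preserves a nondegenerate quadratic character. -/
def HasQuadraticCharacter (F : Type*) {G V : Type*} [Field F] [Group G] [CommGroup V]
    (φ : G →* MulAut V) : Prop :=
  ∃ (v : V) (f : QuadraticCharacter V F), ∀ g, φ g v = v → ∀ u, f (φ g u) = f u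

/-- The sum of the translates of a quadratic character along a family of homomorphisms. -/
def QuadraticCharacter.prodComp {F V W ι : Type*} [Field F] [CommGroup V] [CommGroup W]
    [Fintype ι] (f : QuadraticCharacter W F) (P : ι → V →* W)
    (hP : ∀ u, (∀ w, ∏ i, f.form (P i u) (P i w) = 1) → u = 1) : QuadraticCharacter V F where
  toFun u := ∏ i, f (P i u)
  form := ∏ i, (MonoidHom.compHom' (P i)).comp (f.form.comp (P i))
  map_mul' u w := by
    rw [MonoidHom.finsetProd_apply, MonoidHom.finsetProd_apply, ← Finset.prod_mul_distrib,
      ← Finset.prod_mul_distrib]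
    refine Finset.prod_congr rfl fun i _ ↦ ?_
    rw [_root_.map_mul, f.map_mul]
    rfl
  nondegenerate u hu := hP u fun w ↦ by
    rw [← hu w, MonoidHom.finsetProd_apply, MonoidHom.finsetProd_apply]
    rfl

theorem HasQuadraticCharacter.of_restrictAction {F G V : Type*} [Field F] [Group G] [Finite G]
    [CommGroup V] {φ : G →* MulAut V} {N : Subgroup G} {W : Subgroup V}
    (hW : ∀ n : N, ∀ w ∈ W, (φ.comp N.subtype) n w ∈ W) (P : V →* W) {k : ℕ}
    (hk : (Nat.card W).Coprime k) (hPW : ∀ w : W, P w = w ^ k)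
    (hPx : ∀ x ∉ N, ∀ w : W, P (φ x w) = 1) (hPN : ∀ n ∈ N, ∀ u, (P (φ n u) : V) = φ n (P u))
    (hP : ∀ u, (∀ g, P (φ g u) = 1) → u = 1)
    (h : HasQuadraticCharacter F (restrictAction (φ.comp N.subtype) W hW)) :
    HasQuadraticCharacter F φ := by
  classical
  obtain ⟨v, f, hf⟩ := h
  have := Fintype.ofFinite (G ⧸ N)
  have key (i j : G ⧸ N) (w : W) :
      P (φ i.out⁻¹ (φ j.out w)) = if i = j then w ^ k else 1 := by
    rw [← MulAut.mul_apply, ← map_mul]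
    split_ifs with hij
    · subst hij
      simp [hPW]
    · refine hPx _ (fun h ↦ hij ?_) w
      rw [← i.out_eq', ← j.out_eq', QuotientGroup.eq]
      exact h
  have hpow {a b : W} (hab : a ^ k = b ^ k) : a = b := (powCoprime hk).injective hab
  refine ⟨∏ i : G ⧸ N, φ i.out v, f.prodComp
    (fun i : G ⧸ N ↦ P.comp (φ i.out⁻¹ : MulAut V).toMonoidHom) fun u hu ↦ ?_, fun g hg u ↦ ?_⟩
  · refine hP u fun g ↦ ?_
    set j : G ⧸ N := QuotientGroup.mk g⁻¹ with hj
    have h1 : P (φ j.out⁻¹ u) = 1 := by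
      refine f.nondegenerate _ fun z ↦ ?_
      obtain ⟨w, rfl⟩ := (powCoprime hk).surjective z
      rw [← hu (φ j.out w)]
      rw [Finset.prod_eq_single j]
      · exact congrArg (f.form _) ((if_pos rfl).symm.trans (key j j w).symm)
      · intro i _ hij
        have h2 : P (φ i.out⁻¹ (φ j.out w)) = 1 := (key i j w).trans (if_neg hij)
        change f.form _ (P (φ i.out⁻¹ (φ j.out w))) = 1
        rw [h2, map_one]
      · simp
    have h2 : g * j.out ∈ N := by
      have h3 : ((g⁻¹ : G) : G ⧸ N) = (j.out : G) := by rw [← hj]; exact j.out_eq'.symm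
      rw [QuotientGroup.eq, inv_inv] at h3
      exact h3
    have h4 := hPN _ h2 (φ j.out⁻¹ u)
    rw [← MulAut.mul_apply, ← map_mul, mul_inv_cancel_right, h1, Subgroup.coe_one, map_one] at h4
    exact Subtype.ext h4
  · have h0 (i : G ⧸ N) : P (φ i.out⁻¹ (∏ i : G ⧸ N, φ i.out v)) = v ^ k := by
      rw [map_prod, map_prod]
      simp_rw [key]
      simp
    have h1 (i : G ⧸ N) : ∃ n : N, i.out⁻¹ * g = n * (g⁻¹ • i).out⁻¹ := by
      refine ⟨⟨i.out⁻¹ * g * (g⁻¹ • i).out, ?_⟩, by simp⟩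
      have h2 : ((g⁻¹ * i.out : G) : G ⧸ N) = ((g⁻¹ • i).out : G) := by
        refine Eq.trans ?_ (g⁻¹ • i).out_eq'.symm
        conv_rhs => rw [← i.out_eq']
        rfl
      rw [QuotientGroup.eq, mul_inv_rev, inv_inv] at h2
      exact h2
    change ∏ i : G ⧸ N, f (P (φ i.out⁻¹ (φ g u))) = ∏ i : G ⧸ N, f (P (φ i.out⁻¹ u))
    rw [← Equiv.prod_comp (MulAction.toPerm g⁻¹) (fun i : G ⧸ N ↦ f (P (φ i.out⁻¹ u)))]
    refine Finset.prod_congr rfl fun i _ ↦ ?_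
    obtain ⟨n, hn⟩ := h1 i
    have hPn (x : V) : P (φ i.out⁻¹ (φ g x)) = restrictAction (φ.comp N.subtype) W hW n
        (P (φ (g⁻¹ • i).out⁻¹ x)) := by
      refine Subtype.ext ?_
      rw [coe_restrictAction, ← MulAut.mul_apply, ← map_mul, hn, map_mul, MulAut.mul_apply,
        hPN _ n.2]
      rfl
    rw [hPn, MulAction.toPerm_apply]
    refine hf n (hpow ?_) _
    rw [← map_pow, ← h0 (g⁻¹ • i), ← hPn, hg, h0, h0]

/-- The elements fixed by all elements of a subgroup. -/
def fixedSubgroup {G V : Type*} [Group G] [Group V] (φ : G →* MulAut V) (B : Subgroup G) :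
    Subgroup V where
  carrier := {u | ∀ b ∈ B, φ b u = u}
  mul_mem' ha hb g hg := by rw [map_mul, ha g hg, hb g hg]
  one_mem' g _ := map_one _
  inv_mem' ha g hg := by rw [map_inv, ha g hg]

/-- The norm map onto the fixed elements of a subgroup. -/
def fixedNorm {G V : Type*} [Group G] [CommGroup V] (φ : G →* MulAut V) (B : Subgroup G)
    [Fintype B] : V →* fixedSubgroup φ B :=
  (∏ b : B, (φ b : MulAut V).toMonoidHom).codRestrict (fixedSubgroup φ B) fun u c hc ↦ by
    rw [MonoidHom.finsetProd_apply, map_prod,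
      ← Equiv.prod_comp (Equiv.mulLeft (⟨c, hc⟩ : B)) (fun b : B ↦ (φ b).toMonoidHom u)]
    exact Finset.prod_congr rfl fun b _ ↦ by
      simp

theorem coe_fixedNorm {G V : Type*} [Group G] [CommGroup V] (φ : G →* MulAut V) (B : Subgroup G)
    [Fintype B] (u : V) : (fixedNorm φ B u : V) = ∏ b : B, φ b u := by
  change (∏ b : B, (φ b : MulAut V).toMonoidHom) u = _
  rw [MonoidHom.finsetProd_apply]
  rfl

theorem fixedNorm_of_mem {G V : Type*} [Group G] [CommGroup V] (φ : G →* MulAut V) (B : Subgroup G)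
    [Fintype B] (u : fixedSubgroup φ B) : fixedNorm φ B u = u ^ Fintype.card B := by
  refine Subtype.ext ?_
  rw [coe_fixedNorm, Finset.prod_congr rfl fun (b : B) _ ↦ u.2 b b.2]
  simp

theorem map_mem_fixedSubgroup {G V : Type*} [Group G] [CommGroup V] {φ : G →* MulAut V}
    {B : Subgroup G} {n : G} (hn : n ∈ Subgroup.normalizer (B : Set G)) {u : V}
    (hu : u ∈ fixedSubgroup φ B) : φ n u ∈ fixedSubgroup φ B := fun b hb ↦ by
  have h1 : n⁻¹ * b * n ∈ B := by
    simpa using Subgroup.mem_normalizer_iff.mp (inv_mem hn) b |>.mp hb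
  have h2 := hu _ h1
  rw [← MulAut.mul_apply, ← map_mul]
  conv_rhs => rw [← h2]
  rw [← MulAut.mul_apply, ← map_mul]
  congr 2
  group

theorem coe_fixedNorm_map {G V : Type*} [Group G] [CommGroup V] (φ : G →* MulAut V) (B : Subgroup G)
    [Fintype B] {n : G} (hn : n ∈ Subgroup.normalizer (B : Set G)) (u : V) :
    (fixedNorm φ B (φ n u) : V) = φ n (fixedNorm φ B u) := by
  rw [coe_fixedNorm, coe_fixedNorm, map_prod,
    ← Equiv.prod_comp (B.normalizerMonoidHom ⟨n, hn⟩).toEquiv (fun b : B ↦ φ b (φ n u))]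
  refine Finset.prod_congr rfl fun b _ ↦ ?_
  rw [← MulAut.mul_apply, ← MulAut.mul_apply, ← map_mul, ← map_mul]
  congr 2
  simp

theorem fixedNorm_map_eq_one {G V : Type*} [Group G] [Finite G] [CommGroup V] {φ : G →* MulAut V}
    {A B : Subgroup G} [Fintype B] (hAn : A.Normal) (hA : ∀ a ∈ A, ∀ b ∈ A, a * b = b * a)
    (hBA : B ≤ A) (hB : ∀ C ≤ A, B ≤ C → fixedSubgroup φ C ≠ ⊥ → C ≤ B) {x : G}
    (hx : x ∉ Subgroup.normalizer (B : Set G)) {w : V} (hw : w ∈ fixedSubgroup φ B) :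
    fixedNorm φ B (φ x w) = 1 := by
  by_contra h
  refine hx (Subgroup.mem_normalizer_fintype fun b hb ↦ ?_)
  set C : Subgroup G := B ⊔ Subgroup.closure {x * b * x⁻¹} with hC
  have h1 : C ≤ A := by
    refine sup_le hBA ((Subgroup.closure_le _).mpr ?_)
    rintro _ rfl
    exact hAn.conj_mem _ (hBA hb) _
  refine hB C h1 le_sup_left ?_ ((le_sup_right : _ ≤ C) (Subgroup.subset_closure rfl))
  have h2 : C ≤ (MulAction.stabilizer (MulAut V) (fixedNorm φ B (φ x w) : V)).comap φ := by
    refine sup_le (fun c hc ↦ (fixedNorm φ B (φ x w)).2 c hc) ((Subgroup.closure_le _).mpr ?_)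
    rintro _ rfl
    change φ (x * b * x⁻¹) (fixedNorm φ B (φ x w) : V) = fixedNorm φ B (φ x w)
    rw [coe_fixedNorm, map_prod]
    refine Finset.prod_congr rfl fun c _ ↦ ?_
    have h3 : x * b * x⁻¹ * c = c * (x * b * x⁻¹) := hA _ (hAn.conj_mem _ (hBA hb) _) _ (hBA c.2)
    have h4 : φ (x * b * x⁻¹) (φ x w) = φ x w := by
      rw [← MulAut.mul_apply, ← map_mul, inv_mul_cancel_right, map_mul, MulAut.mul_apply, hw b hb]
    rw [← MulAut.mul_apply, ← map_mul, h3, map_mul, MulAut.mul_apply, h4]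
  rw [ne_eq, Subgroup.eq_bot_iff_forall]
  push Not
  exact ⟨_, fun c hc ↦ h2 hc, fun h3 ↦ h (Subtype.ext h3)⟩

theorem isIrreducibleAction_restrictAction_fixedSubgroup {G V : Type*} [Group G] [Finite G]
    [CommGroup V] {φ : G →* MulAut V} (hφ : IsIrreducibleAction φ) {B : Subgroup G} [Fintype B]
    {N : Subgroup G} (hN : ∀ n : N, ∀ w ∈ fixedSubgroup φ B, (φ.comp N.subtype) n w ∈
      fixedSubgroup φ B) (hk : (Nat.card (fixedSubgroup φ B)).Coprime (Fintype.card B))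
    (hx : ∀ x ∉ N, ∀ w ∈ fixedSubgroup φ B, fixedNorm φ B (φ x w) = 1) :
    IsIrreducibleAction (restrictAction (φ.comp N.subtype) (fixedSubgroup φ B) hN) := by
  intro U hU
  refine or_iff_not_imp_left.mpr fun hbot ↦ ?_
  set U' : Subgroup V := Subgroup.closure {y | ∃ g, ∃ w ∈ U, φ g w = y} with hU'
  have h1 : U' = ⊤ := by
    refine (hφ U' fun g w hw ↦ ?_).resolve_left fun h ↦ hbot ?_
    · have h2 : U' ≤ U'.comap (φ g).toMonoidHom := by
        refine (Subgroup.closure_le _).mpr ?_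
        rintro _ ⟨x, w, hw, rfl⟩
        exact Subgroup.subset_closure ⟨g * x, w, hw, by simp⟩
      exact h2 hw
    · rw [Subgroup.eq_bot_iff_forall]
      intro w hw
      have h2 : (w : V) ∈ U' := Subgroup.subset_closure ⟨1, w, hw, by simp⟩
      rw [h, Subgroup.mem_bot] at h2
      exact Subtype.ext h2
  have h3 : U' ≤ U.comap (fixedNorm φ B) := by
    refine (Subgroup.closure_le _).mpr ?_
    rintro _ ⟨x, w, hw, rfl⟩
    by_cases hxN : x ∈ N
    · have h4 := fixedNorm_of_mem φ B (restrictAction (φ.comp N.subtype) (fixedSubgroup φ B) hN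
        ⟨x, hxN⟩ w)
      change fixedNorm φ B (φ x w) = _ at h4
      change fixedNorm φ B (φ x w) ∈ U
      rw [h4]
      exact U.pow_mem (hU _ _ hw) _
    · change fixedNorm φ B (φ x w) ∈ U
      rw [hx x hxN w w.2]
      exact U.one_mem
  rw [eq_top_iff]
  intro w _
  obtain ⟨z, rfl⟩ := (powCoprime hk).surjective w
  have h4 : (z : V) ∈ U.comap (fixedNorm φ B) := h3 (h1 ▸ Subgroup.mem_top _)
  rw [Subgroup.mem_comap, fixedNorm_of_mem] at h4
  exact h4

theorem exists_hasQuadraticCharacter_imp {F G V : Type*} [Field F] [Group G] [Finite G]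
    [CommGroup V] [Finite V] {φ : G →* MulAut V} (hφ : Function.Injective φ)
    (hc : (Nat.card G).Coprime (Nat.card V)) (hirr : IsIrreducibleAction φ) {A : Subgroup G}
    (hAn : A.Normal) (hA : ∀ a ∈ A, ∀ b ∈ A, a * b = b * a) {a : G} (haA : a ∈ A) (ha : a ≠ 1)
    {u : V} (hu : u ≠ 1) (hau : φ a u = u) :
    ∃ (N : Subgroup G) (W : Subgroup V) (hW : ∀ n : N, ∀ w ∈ W, (φ.comp N.subtype) n w ∈ W),
      Nontrivial W ∧ Nat.card W < Nat.card V ∧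
      IsIrreducibleAction (restrictAction (φ.comp N.subtype) W hW) ∧
      (HasQuadraticCharacter F (restrictAction (φ.comp N.subtype) W hW) →
        HasQuadraticCharacter F φ) := by
  have hmem : Subgroup.zpowers a ∈ {C : Subgroup G | C ≤ A ∧ fixedSubgroup φ C ≠ ⊥} := by
    refine ⟨(Subgroup.zpowers_le).mpr haA, fun h ↦ hu ?_⟩
    rw [← Subgroup.mem_bot, ← h]
    intro b hb
    have h1 : Subgroup.zpowers a ≤ (MulAction.stabilizer (MulAut V) u).comap φ :=
      Subgroup.zpowers_le.mpr hau
    exact h1 hb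
  obtain ⟨B, haB, ⟨hBA, hBbot⟩, hmax⟩ := (Set.toFinite _).exists_le_maximal hmem
  have := Fintype.ofFinite B
  have hB : ∀ C ≤ A, B ≤ C → fixedSubgroup φ C ≠ ⊥ → C ≤ B := fun C hC hBC h ↦ hmax ⟨hC, h⟩ hBC
  set N := Subgroup.normalizer (B : Set G) with hN
  have hW : ∀ n : N, ∀ w ∈ fixedSubgroup φ B, (φ.comp N.subtype) n w ∈ fixedSubgroup φ B :=
    fun n w hw ↦ map_mem_fixedSubgroup n.2 hw
  have hx : ∀ x ∉ N, ∀ w ∈ fixedSubgroup φ B, fixedNorm φ B (φ x w) = 1 := fun x hx w hw ↦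
    fixedNorm_map_eq_one hAn hA hBA hB hx hw
  have hk : (Nat.card (fixedSubgroup φ B)).Coprime (Fintype.card B) := by
    rw [← Nat.card_eq_fintype_card]
    exact (hc.coprime_dvd_left B.card_subgroup_dvd_card).symm.coprime_dvd_left
      (fixedSubgroup φ B).card_subgroup_dvd_card
  have hnt := (Subgroup.nontrivial_iff_ne_bot _).mpr hBbot
  refine ⟨N, fixedSubgroup φ B, hW, hnt, ?_,
    isIrreducibleAction_restrictAction_fixedSubgroup hirr hW hk hx,
    HasQuadraticCharacter.of_restrictAction hW (fixedNorm φ B) hk (fixedNorm_of_mem φ B)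
      (fun x hxN w ↦ hx x hxN w w.2) (fun n hn u ↦ coe_fixedNorm_map φ B hn u) ?_⟩
  · refine lt_of_le_of_ne (Subgroup.card_le_card_group _) fun h ↦ ha (hφ ?_)
    rw [Subgroup.card_eq_iff_eq_top] at h
    rw [map_one]
    ext x
    have h1 : x ∈ fixedSubgroup φ B := h ▸ Subgroup.mem_top x
    exact h1 a (haB (Subgroup.mem_zpowers a))
  · let K : Subgroup V := ⨅ g, (fixedNorm φ B).ker.comap (φ g).toMonoidHom
    have hK (x : V) : x ∈ K ↔ ∀ g, fixedNorm φ B (φ g x) = 1 := by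
      simp only [K, Subgroup.mem_iInf]
      rfl
    have h1 : K = ⊥ := by
      refine (hirr K fun g x hx ↦ ?_).resolve_right fun h ↦ ?_
      · rw [hK] at hx ⊢
        intro g'
        rw [← MulAut.mul_apply, ← map_mul]
        exact hx _
      · obtain ⟨w, hw⟩ := exists_ne (1 : fixedSubgroup φ B)
        have h2 := (hK w).mp (h ▸ Subgroup.mem_top _) 1
        rw [map_one, MulAut.one_apply, fixedNorm_of_mem] at h2
        exact hw (eq_one_of_pow_eq_one_of_coprime h2 hk.symm)
    intro x hx
    rw [← Subgroup.mem_bot, ← h1, hK]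
    exact hx

/-- The bilinear form `(x, y) ↦ ψ (c x y)` attached to an additive character `ψ`. -/
def AddChar.mulForm {R M : Type*} [CommRing R] [CommGroup M] (ψ : AddChar R M) (c : R) :
    Multiplicative R →* Multiplicative R →* M :=
  MonoidHom.mk' (fun x ↦ MonoidHom.mk' (fun y ↦ ψ (c * x.toAdd * y.toAdd)) fun y z ↦ by
    rw [toAdd_mul, mul_add, ψ.map_add_eq_mul]) fun x y ↦ by
    ext z
    simp [mul_add, add_mul, ψ.map_add_eq_mul]

theorem AddChar.mulForm_apply {R M : Type*} [CommRing R] [CommGroup M] (ψ : AddChar R M) (c : R)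
    (x y : Multiplicative R) : ψ.mulForm c x y = ψ (c * x.toAdd * y.toAdd) := rfl

theorem zmod_two_val_add : ∀ x y : ZMod 2,
    x.val + y.val + 2 * (1 * x * y).val = (x + y).val ∨
      x.val + y.val + 2 * (1 * x * y).val = (x + y).val + 4 := by
  decide

theorem exists_even_quadraticCharacter_zmod (F : Type*) [Field F] [IsAlgClosed F] [CharZero F]
    (p : ℕ) [hp : Fact p.Prime] :
    ∃ f : QuadraticCharacter (Multiplicative (ZMod p)) F, ∀ u, f u⁻¹ = f u := by
  obtain ⟨ζ', hζ'⟩ := HasEnoughRootsOfUnity.exists_primitiveRoot F p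
  set ζ : Fˣ := (hζ'.isUnit hp.out.ne_zero).unit with hζdef
  have hζ : IsPrimitiveRoot ζ p := hζ'.isUnit_unit hp.out.ne_zero
  set ψ : AddChar (ZMod p) Fˣ := AddChar.zmodChar p hζ.pow_eq_one with hψdef
  have hψ : ψ.IsPrimitive := AddChar.zmodChar_primitive_of_primitive_root p hζ
  have hnd {c : ZMod p} (hc : c ≠ 0) (u : Multiplicative (ZMod p))
      (h : ∀ w, ψ.mulForm c u w = 1) : u = 1 := by
    by_contra hu
    refine hψ (a := c * u.toAdd) (mul_ne_zero hc fun h0 ↦ hu h0) ?_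
    ext y
    exact congrArg Units.val (h (Multiplicative.ofAdd y))
  rcases eq_or_ne p 2 with rfl | hp2
  · obtain ⟨η', hη'⟩ := IsAlgClosed.exists_pow_nat_eq (ζ : F) two_pos
    have hη0 : η' ≠ 0 := by
      rintro rfl
      exact ζ.ne_zero (by rw [← hη', zero_pow two_ne_zero])
    set η : Fˣ := Units.mk0 η' hη0
    have hη : η ^ 2 = ζ := Units.ext hη'
    refine ⟨⟨fun x ↦ η ^ (x.toAdd.val), ψ.mulForm 1, fun u w ↦ ?_, hnd one_ne_zero⟩, fun u ↦ ?_⟩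
    · rw [AddChar.mulForm_apply, hψdef, AddChar.zmodChar_apply, ← hη, ← pow_mul, ← pow_add,
        ← pow_add, toAdd_mul]
      have h4 : η ^ 4 = 1 := by
        rw [show 4 = 2 * 2 from rfl, pow_mul, hη, hζ.pow_eq_one]
      rcases zmod_two_val_add u.toAdd w.toAdd with h | h
      · rw [h]
      · rw [h, pow_add, h4, mul_one]
    · change η ^ (-u.toAdd).val = η ^ u.toAdd.val
      rw [ZMod.neg_eq_self_mod_two]
  · have h2 : (2 : ZMod p) ≠ 0 := by
      intro h
      have h' : ((2 : ℕ) : ZMod p) = 0 := h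
      rw [ZMod.natCast_eq_zero_iff] at h'
      exact hp2 ((Nat.prime_dvd_prime_iff_eq hp.out Nat.prime_two).mp h')
    refine ⟨⟨fun x ↦ ψ (x.toAdd ^ 2), ψ.mulForm 2, fun u w ↦ ?_, hnd h2⟩, fun u ↦ ?_⟩
    · rw [AddChar.mulForm_apply, ← ψ.map_add_eq_mul, ← ψ.map_add_eq_mul, toAdd_mul]
      congr 1
      ring
    · change ψ ((-u.toAdd) ^ 2) = ψ (u.toAdd ^ 2)
      rw [neg_sq]

theorem exists_addEquiv_fin (K W : Type*) [Field K] [AddCommGroup W] [Finite W] [Module K W] :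
    ∃ n, Nonempty (W ≃+ (Fin n → K)) :=
  ⟨_, ⟨(Module.finBasis K W).equivFun.toAddEquiv⟩⟩

theorem exists_even_quadraticCharacter (F : Type*) {V : Type*} [Field F] [IsAlgClosed F]
    [CharZero F] [CommGroup V] [Finite V] (p : ℕ) [hp : Fact p.Prime] (hV : ∀ u : V, u ^ p = 1) :
    ∃ f : QuadraticCharacter V F, ∀ u, f u⁻¹ = f u := by
  obtain ⟨f, hf⟩ := exists_even_quadraticCharacter_zmod F p
  obtain ⟨n, ⟨e⟩⟩ :=
    @exists_addEquiv_fin (ZMod p) (Additive V) _ _ _ (AddCommGroup.zmodModule hV)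
  let P (i : Fin n) : V →* Multiplicative (ZMod p) :=
    AddMonoidHom.toMultiplicativeRight
      ((Pi.evalAddMonoidHom _ i).comp e.toAddMonoidHom)
  refine ⟨f.prodComp P fun u hu ↦ ?_, fun u ↦ ?_⟩
  · have h1 (i) : P i u = 1 := by
      refine f.nondegenerate _ fun z ↦ ?_
      rw [← hu (e.symm (Pi.single i z.toAdd)).toMul, Finset.prod_eq_single i]
      · congr 1
        change z = Multiplicative.ofAdd (e (e.symm _) i)
        simp
      · intro j _ hj
        have h2 : P j (e.symm (Pi.single i z.toAdd)).toMul = 1 := by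
          change Multiplicative.ofAdd (e (e.symm _) j) = _
          simp [hj]
        rw [h2, map_one]
      · simp
    have h3 : e (Additive.ofMul u) = 0 := funext h1
    exact e.map_eq_zero_iff.mp h3
  · change ∏ i, f (P i u⁻¹) = ∏ i, f (P i u)
    simp_rw [map_inv, hf]

theorem exists_quadraticCharacter_of_involution (F : Type*) {V : Type*} [Field F] [IsAlgClosed F]
    [CharZero F] [CommGroup V] [Finite V] (p : ℕ) [hp : Fact p.Prime] (hV : ∀ u : V, u ^ p = 1)
    (s : MulAut V) (hs : ∀ u, s (s u) = u) (hps : p ≠ 2 ∨ s = 1) :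
    ∃ f : QuadraticCharacter V F, ∀ u, f (s u) = f u := by
  rcases hps with hp2 | rfl
  · let V₁ : Subgroup V := (displacement s).ker
    let V₂ : Subgroup V := (s.toMonoidHom * MonoidHom.id V).ker
    have hV₁ (u : V) : u ∈ V₁ ↔ s u = u := mem_ker_displacement
    have hV₂ (u : V) : u ∈ V₂ ↔ s u * u = 1 := Iff.rfl
    let P₁ : V →* V₁ := (s.toMonoidHom * MonoidHom.id V).codRestrict V₁ fun u ↦ by
      rw [hV₁]
      change s (s u * u) = s u * u
      rw [map_mul, hs, mul_comm]
    let P₂ : V →* V₂ := (displacement s).codRestrict V₂ fun u ↦ by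
      rw [hV₂, displacement_apply, map_div, hs, div_mul_div_cancel, div_self']
    obtain ⟨f₁, hf₁⟩ := exists_even_quadraticCharacter F (V := V₁) p fun u ↦ Subtype.ext (hV u)
    obtain ⟨f₂, hf₂⟩ := exists_even_quadraticCharacter F (V := V₂) p fun u ↦ Subtype.ext (hV u)
    have hsq {u : V} (h : u ^ 2 = 1) : u = 1 := by
      have h1 : Nat.Coprime 2 p := (Nat.coprime_primes Nat.prime_two hp.out).mpr hp2.symm
      rw [← pow_one u, ← h1, pow_gcd_eq_one]
      exact ⟨h, hV u⟩
    refine ⟨⟨fun u ↦ f₁ (P₁ u) * f₂ (P₂ u), (MonoidHom.compHom' P₁).comp (f₁.form.comp P₁) *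
      (MonoidHom.compHom' P₂).comp (f₂.form.comp P₂), fun u w ↦ ?_, fun u hu ↦ ?_⟩, fun u ↦ ?_⟩
    · change _ = _ * _ * (f₁.form (P₁ u) (P₁ w) * f₂.form (P₂ u) (P₂ w))
      rw [map_mul P₁, map_mul P₂, f₁.map_mul, f₂.map_mul]
      ac_rfl
    · change ∀ w, f₁.form (P₁ u) (P₁ w) * f₂.form (P₂ u) (P₂ w) = 1 at hu
      have hsurj {W : Subgroup V} (z : W) : ∃ w : W, w ^ 2 = z := by
        have h1 : (Nat.card W).Coprime 2 := by
          rw [Nat.coprime_comm, Nat.Prime.coprime_iff_not_dvd Nat.prime_two]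
          intro h
          obtain ⟨x, hx⟩ := exists_prime_orderOf_dvd_card' 2 h
          have h2 : (x : V) = 1 := hsq (by
            have := pow_orderOf_eq_one x
            rw [hx] at this
            exact congrArg Subtype.val this)
          have h3 : x = 1 := Subtype.ext h2
          rw [h3, orderOf_one] at hx
          omega
        exact (powCoprime h1).surjective z
      have h1 : P₁ u = 1 := by
        refine f₁.nondegenerate _ fun z ↦ ?_
        obtain ⟨w, rfl⟩ := hsurj z
        have h2 := hu w
        have h3 : P₂ w = 1 := Subtype.ext (by
          change displacement s w = 1
          rw [displacement_apply, (hV₁ _).mp w.2, div_self'])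
        have h4 : P₁ w = w ^ 2 := Subtype.ext (by
          change s w * w = w ^ 2
          rw [(hV₁ _).mp w.2, sq])
        rwa [h3, map_one, mul_one, h4] at h2
      have h1' : P₂ u = 1 := by
        refine f₂.nondegenerate _ fun z ↦ ?_
        obtain ⟨w, rfl⟩ := hsurj z
        have h2 := hu (w⁻¹ : V₂)
        have h3 : P₁ (w⁻¹ : V₂) = 1 := Subtype.ext ((hV₂ _).mp (w⁻¹).2)
        have h4 : P₂ (w⁻¹ : V₂) = w ^ 2 := Subtype.ext (by
          change displacement s (w⁻¹ : V₂) = w ^ 2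
          rw [displacement_apply, Subgroup.coe_inv, map_inv,
            eq_inv_of_mul_eq_one_left ((hV₂ _).mp w.2)]
          rw [inv_inv, div_inv_eq_mul, sq])
        rwa [h3, map_one, one_mul, h4] at h2
      have h5 : s u * u = 1 := congrArg Subtype.val h1
      have h6 : s u / u = 1 := congrArg Subtype.val h1'
      refine hsq ?_
      rw [div_eq_one] at h6
      rw [sq]
      nth_rw 1 [← h6]
      exact h5
    · change f₁ (P₁ (s u)) * f₂ (P₂ (s u)) = f₁ (P₁ u) * f₂ (P₂ u)
      have h1 : P₁ (s u) = P₁ u := Subtype.ext (by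
        change s (s u) * s u = s u * u
        rw [hs, mul_comm])
      have h2 : P₂ (s u) = (P₂ u)⁻¹ := Subtype.ext (by
        change displacement s (s u) = (displacement s u)⁻¹
        rw [displacement_apply, displacement_apply, hs, inv_div])
      rw [h1, h2, hf₂]
  · obtain ⟨f, -⟩ := exists_even_quadraticCharacter F p hV
    exact ⟨f, fun u ↦ rfl⟩

theorem mul_comm_of_mem_normalClosure {G : Type*} [Group G] {S : Set G}
    (h : ∀ x ∈ S, ∀ y ∈ S, ∀ g : G, Commute x (g * y * g⁻¹)) {a b : G}
    (ha : a ∈ Subgroup.normalClosure S) (hb : b ∈ Subgroup.normalClosure S) : a * b = b * a := by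
  have hcomm : ∀ x ∈ Group.conjugatesOfSet S, ∀ y ∈ Group.conjugatesOfSet S, x * y = y * x := by
    intro x hx y hy
    obtain ⟨x', hx', hxc⟩ := Group.mem_conjugatesOfSet_iff.1 hx
    obtain ⟨y', hy', hyc⟩ := Group.mem_conjugatesOfSet_iff.1 hy
    obtain ⟨c, rfl⟩ := isConj_iff.1 hxc
    obtain ⟨d, rfl⟩ := isConj_iff.1 hyc
    have := (h x' hx' y' hy' (c⁻¹ * d)).map (MulAut.conj c)
    simpa [mul_assoc] using this.eq
  have := Subgroup.isMulCommutative_closure hcomm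
  exact setLike_mul_comm (s := Subgroup.closure (Group.conjugatesOfSet S)) ha hb

theorem exists_normal_commutative_centralizer_le (G : Type*) [Group G] [Finite G]
    [Group.IsNilpotent G] : ∃ A : Subgroup G, A.Normal ∧ (∀ a ∈ A, ∀ b ∈ A, a * b = b * a) ∧
      ∀ c, (∀ a ∈ A, a * c = c * a) → c ∈ A := by
  obtain ⟨A, -, hmax⟩ := Set.Finite.exists_le_maximal
    (Set.toFinite {A : Subgroup G | A.Normal ∧ ∀ a ∈ A, ∀ b ∈ A, a * b = b * a})
    (a := ⊥) ⟨inferInstance, by simp⟩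
  obtain ⟨hAn, hA⟩ := hmax.prop
  refine ⟨A, hAn, hA, ?_⟩
  obtain ⟨n, hn⟩ := Subgroup.nilpotent_iff_lowerCentralSeries.1 ‹Group.IsNilpotent G›
  suffices h : ∀ j, (∀ c ∈ (⊤ : Subgroup G).lowerCentralSeries j,
      (∀ a ∈ A, a * c = c * a) → c ∈ A) from
    fun c hc ↦ h 0 c trivial hc
  intro j
  have hconj : ∀ c, (∀ a ∈ A, a * c = c * a) → ∀ g : G, ∀ a ∈ A,
      a * (g * c * g⁻¹) = g * c * g⁻¹ * a := by
    intro c hc g a ha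
    have := congrArg (fun x ↦ g * x * g⁻¹) (hc _ (hAn.conj_mem a ha g⁻¹))
    simpa [mul_assoc] using this
  have step : ∀ j, (∀ c ∈ (⊤ : Subgroup G).lowerCentralSeries (j + 1),
      (∀ a ∈ A, a * c = c * a) → c ∈ A) → (∀ c ∈ (⊤ : Subgroup G).lowerCentralSeries j,
      (∀ a ∈ A, a * c = c * a) → c ∈ A) := by
    intro j ih c hcj hc
    have hcomm : ∀ g : G, g * c * g⁻¹ * c⁻¹ ∈ A := by
      intro g
      refine ih _ ?_ ?_
      · have := inv_mem (Subgroup.commutator_mem_commutator hcj (Subgroup.mem_top g))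
        simpa [commutatorElement_def, mul_assoc] using this
      · intro a ha
        have h1 := hconj c hc g a ha
        have h2 := hc a ha
        calc a * (g * c * g⁻¹ * c⁻¹) = a * (g * c * g⁻¹) * c⁻¹ := by group
          _ = g * c * g⁻¹ * (a * c⁻¹) := by rw [h1]; group
          _ = g * c * g⁻¹ * (c⁻¹ * a) := by
            rw [(Commute.inv_right (show Commute a c from h2)).eq]
          _ = _ := by group
    have hle : A ≤ Subgroup.normalClosure (insert c (A : Set G)) := fun a ha ↦
      Subgroup.subset_normalClosure (Set.mem_insert_of_mem _ ha)
    refine hmax.le_of_ge ⟨inferInstance, fun a ha b hb ↦ mul_comm_of_mem_normalClosure ?_ ha hb⟩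
      hle (Subgroup.subset_normalClosure (Set.mem_insert _ _))
    rintro x (rfl | hx) y (rfl | hy) g
    · have h1 := hc _ (hcomm g)
      have : g * y * g⁻¹ = g * y * g⁻¹ * y⁻¹ * y := by group
      rw [this]
      exact Commute.mul_right (show Commute _ _ from h1.symm) (Commute.refl _)
    · exact (show Commute _ _ from hc _ (hAn.conj_mem y hy g)).symm
    · exact hconj y hc g x hx
    · exact hA x hx _ (hAn.conj_mem y hy g)
  have : ∀ i, ∀ c ∈ (⊤ : Subgroup G).lowerCentralSeries (n - i),
      (∀ a ∈ A, a * c = c * a) → c ∈ A := by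
    intro i
    induction i with
    | zero =>
      intro c hc _
      rw [Nat.sub_zero, hn, Subgroup.mem_bot] at hc
      exact hc ▸ A.one_mem
    | succ i ih =>
      rcases Nat.lt_or_ge i n with h | h
      · refine step _ ?_
        rwa [show n - (i + 1) + 1 = n - i by lia]
      · rwa [show n - (i + 1) = n - i by lia]
  intro c hc
  have h0 := this n c
  rw [Nat.sub_self] at h0
  exact h0 trivial

theorem isCyclic_of_isIrreducibleAction {A W : Type*} [CommGroup A] [Finite A] [CommGroup W]
    [Nontrivial W] {ψ : A →* MulAut W} (hψ : Function.Injective ψ) (hirr : IsIrreducibleAction ψ) :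
    IsCyclic A := by
  let θ : A →* AddMonoid.End (Additive W) :=
    { toFun := fun a ↦ MonoidHom.toAdditive (ψ a).toMonoidHom
      map_one' := by rw [map_one]; rfl
      map_mul' := fun a b ↦ by rw [map_mul]; rfl }
  have hθ (a : A) (w : W) : θ a (Additive.ofMul w) = Additive.ofMul (ψ a w) := rfl
  let R := Subring.closure (Set.range θ)
  have hR : IsMulCommutative R := Subring.isMulCommutative_closure <| by
    rintro _ ⟨a, rfl⟩ _ ⟨b, rfl⟩
    rw [← map_mul, ← map_mul, mul_comm]
  have hmem (a : A) : θ a ∈ R := Subring.subset_closure ⟨a, rfl⟩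
  have hker : ∀ r ∈ R, r ≠ 0 → ∀ w, r w = 0 → w = 0 := by
    intro r hr hr0 w hw
    let K : Subgroup W := AddSubgroup.toSubgroup' r.ker
    have hK (w : W) : w ∈ K ↔ r (Additive.ofMul w) = 0 := Iff.rfl
    have hinv : ∀ a, ∀ w ∈ K, ψ a w ∈ K := by
      intro a w hw
      rw [hK] at hw ⊢
      have : r * θ a = θ a * r := setLike_mul_comm (s := R) hr (hmem a)
      have : r (θ a (Additive.ofMul w)) = θ a (r (Additive.ofMul w)) :=
        DFunLike.congr_fun this (Additive.ofMul w)
      rwa [hw, map_zero] at this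
    rcases hirr K hinv with h | h
    · have : w.toMul ∈ K := hw
      rw [h, Subgroup.mem_bot] at this
      exact this
    · refine absurd ?_ hr0
      ext x
      have : x.toMul ∈ K := by rw [h]; trivial
      exact this
  let _ : CommRing R := { (inferInstance : Ring R) with mul_comm := hR.is_comm.comm }
  have : Nontrivial R := by
    obtain ⟨w, hw⟩ := exists_ne (1 : W)
    refine ⟨1, 0, fun h ↦ hw ?_⟩
    have := DFunLike.congr_fun (congrArg Subtype.val h) (Additive.ofMul w)
    exact this
  have : NoZeroDivisors R := ⟨fun {r s} h ↦ by
    by_cases hr : r = 0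
    · exact Or.inl hr
    refine Or.inr (Subtype.ext (DFunLike.ext _ _ fun w ↦ ?_))
    refine hker r r.2 (fun h ↦ hr (Subtype.ext h)) _ ?_
    exact DFunLike.congr_fun (congrArg Subtype.val h) w⟩
  have : IsDomain R := NoZeroDivisors.to_isDomain R
  refine isCyclic_of_injective_ringHom (R := R) (θ.codRestrict R.toSubmonoid hmem) ?_
  intro a b hab
  refine hψ (MulEquiv.ext fun w ↦ ?_)
  exact DFunLike.congr_fun (congrArg Subtype.val hab) (Additive.ofMul w)

theorem isCyclic_of_fixedPointFree {A V : Type*} [CommGroup A] [Finite A] [CommGroup V] [Finite V]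
    [Nontrivial V] {ψ : A →* MulAut V} (hψ : ∀ a u, u ≠ 1 → ψ a u = u → a = 1) : IsCyclic A := by
  obtain ⟨W, -, hmin⟩ := Set.Finite.exists_le_minimal
    (Set.toFinite {W : Subgroup V | W ≠ ⊥ ∧ ∀ a, ∀ w ∈ W, ψ a w ∈ W})
    (a := ⊤) ⟨top_ne_bot, fun _ _ _ ↦ trivial⟩
  obtain ⟨hW, hinv⟩ := hmin.prop
  have hnt : Nontrivial W := (Subgroup.nontrivial_iff_ne_bot W).2 hW
  refine isCyclic_of_isIrreducibleAction (ψ := restrictAction ψ W hinv) ?_ ?_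
  · rw [injective_iff_map_eq_one]
    intro a ha
    obtain ⟨w, hw⟩ := exists_ne (1 : W)
    refine hψ a w (by simpa using hw) ?_
    rw [← coe_restrictAction ψ W hinv, ha, MulAut.one_apply]
  · intro U hU
    by_cases hbot : U = ⊥
    · exact Or.inl hbot
    right
    have hle : U.map W.subtype ≤ W := Subgroup.map_subtype_le U
    have := hmin.le_of_le ⟨?_, ?_⟩ hle
    · rw [← top_le_iff]
      intro w _
      obtain ⟨u, hu, huw⟩ := this w.2
      rwa [← Subtype.ext huw]
    · rwa [Ne, Subgroup.map_eq_bot_iff_of_injective _ W.subtype_injective]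
    · rintro a _ ⟨u, hu, rfl⟩
      exact ⟨_, hU a u hu, coe_restrictAction ψ W hinv a u⟩

theorem prime_dvd_geom_sum_imp {l : ℕ} {k : ℤ} {q : ℕ} (hl : l.Prime) (hq : q.Prime)
    (hk : (q : ℤ) ∣ k - 1) (h : (q : ℤ) ∣ ∑ i ∈ Finset.range l, k ^ i) : q = l := by
  have h1 : (∑ i ∈ Finset.range l, k ^ i) ≡ ∑ i ∈ Finset.range l, 1 [ZMOD q] := by
    refine Int.ModEq.sum fun i _ ↦ ?_
    have : k ≡ 1 [ZMOD q] := (Int.modEq_iff_dvd.2 hk).symm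
    simpa using this.pow i
  have h2 : (q : ℤ) ∣ (l : ℤ) := by
    have := h1.dvd
    simp only [Finset.sum_const, Finset.card_range, nsmul_eq_mul, mul_one] at this
    exact (dvd_sub_left h).1 this
  exact (Nat.prime_dvd_prime_iff_eq hq hl).1 (Int.natCast_dvd_natCast.1 h2)

theorem dvd_sub_one_of_dvd_geom_sum {l d : ℕ} {k : ℤ} (hl : l.Prime) (hd : d ≠ 0)
    (h : (d : ℤ) ∣ ∑ i ∈ Finset.range l, k ^ i)
    (hq : ∀ q : ℕ, q.Prime → q ∣ d → (q : ℤ) ∣ k - 1) (h2 : l = 2 → k % 4 ≠ 3) :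
    (d : ℤ) ∣ k - 1 := by
  have huniq : ∀ {q : ℕ}, q.Prime → q ∣ d → q = l := fun {q} hqp hqd ↦
    prime_dvd_geom_sum_imp hl hqp (hq q hqp hqd) ((Int.natCast_dvd_natCast.2 hqd).trans h)
  have hpow := Nat.eq_prime_pow_of_unique_prime_dvd hd huniq
  obtain ⟨e, he⟩ : ∃ e, d = l ^ e := ⟨_, hpow⟩
  rcases Nat.lt_or_ge e 2 with h' | h'
  · interval_cases e
    · simp [he]
    · rw [pow_one] at he
      exact he ▸ hq l hl (he ▸ dvd_rfl)
  exfalso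
  have hsq : l ^ 2 ∣ d := he ▸ pow_dvd_pow l h'
  have hld : l ∣ d := (dvd_pow_self l two_ne_zero).trans hsq
  have hS : (l : ℤ) ^ 2 ∣ ∑ i ∈ Finset.range l, k ^ i := by
    refine dvd_trans ?_ h
    exact_mod_cast hsq
  rcases hl.eq_two_or_odd' with rfl | hodd
  · simp only [Finset.sum_range_succ, Finset.sum_range_zero] at hS
    have := h2 rfl
    norm_num at hS
    lia
  · obtain ⟨b, hb⟩ := hq l hl hld
    have h3 := odd_sq_dvd_geom_sum₂_sub (1 : ℤ) b hodd
    rw [← hb] at h3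
    simp only [one_pow, mul_one, add_sub_cancel] at h3
    have h4 : (l : ℤ) ^ 2 ∣ l := (dvd_sub_right hS).1 h3
    have h5 : l ^ 2 ∣ l := by exact_mod_cast h4
    have := Nat.le_of_dvd hl.pos h5
    nlinarith [hl.two_le]

theorem exists_conj_eq_zpow {G : Type*} [Group G] (A : Subgroup G) [A.Normal] [IsCyclic A] (g : G) :
    ∃ k : ℤ, ∀ a ∈ A, g * a * g⁻¹ = a ^ k := by
  obtain ⟨k, hk⟩ := MonoidHom.map_cyclic (MulAut.conjNormal (H := A) g).toMonoidHom
  refine ⟨k, fun a ha ↦ ?_⟩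
  have := congrArg Subtype.val (hk ⟨a, ha⟩)
  simpa using this

theorem exists_zpow_sub_one_pow_eq_one {G : Type*} [Group G] [Group.IsNilpotent G]
    {A : Subgroup G} {h : G} {k : ℤ} (hk : ∀ a ∈ A, h * a * h⁻¹ = a ^ k) :
    ∃ c : ℕ, ∀ a ∈ A, a ^ ((k - 1) ^ c) = 1 := by
  obtain ⟨n, hn⟩ := Subgroup.nilpotent_iff_lowerCentralSeries.1 ‹Group.IsNilpotent G›
  have key : ∀ i, ∀ a ∈ A, a ^ ((k - 1) ^ i) ∈ (⊤ : Subgroup G).lowerCentralSeries i := by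
    intro i
    induction i with
    | zero => exact fun _ _ ↦ trivial
    | succ i ih =>
      intro a ha
      have hb := A.zpow_mem ha ((k - 1) ^ i)
      have := inv_mem (Subgroup.commutator_mem_commutator (ih a ha) (Subgroup.mem_top h))
      rw [commutatorElement_inv, commutatorElement_def, hk _ hb, ← zpow_sub_one, ← zpow_mul,
        ← pow_succ] at this
      exact this
  exact ⟨n, fun a ha ↦ by simpa [hn] using key n a ha⟩

theorem mul_pow_eq_zpow_geom_sum_mul {G : Type*} [Group G] {b h : G} {k : ℤ}
    (hb : h * b * h⁻¹ = b ^ k) (m : ℕ) :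
    (b * h) ^ m = b ^ (∑ i ∈ Finset.range m, k ^ i) * h ^ m := by
  have hconj : ∀ m : ℕ, h ^ m * b = b ^ (k ^ m) * h ^ m := by
    intro m
    induction m with
    | zero => simp
    | succ m ih =>
      have h1 : h * b ^ (k ^ m) * h⁻¹ = b ^ (k ^ (m + 1)) := by
        rw [← conj_zpow, hb, ← zpow_mul, pow_succ']
      rw [pow_succ', mul_assoc, ih, ← h1]
      group
  induction m with
  | zero => simp
  | succ m ih =>
    rw [pow_succ, ih, Finset.sum_range_succ, zpow_add, mul_assoc, ← mul_assoc (h ^ m), hconj m,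
      pow_succ]
    simp only [mul_assoc]

theorem commutator_mem_of_centralizer_le {G : Type*} [Group G] {A : Subgroup G} [A.Normal]
    [IsCyclic A] (hA : ∀ c, (∀ a ∈ A, a * c = c * a) → c ∈ A) (g h : G) :
    g * h * g⁻¹ * h⁻¹ ∈ A := by
  obtain ⟨k, hk⟩ := exists_conj_eq_zpow A g
  obtain ⟨m, hm⟩ := exists_conj_eq_zpow A h
  refine hA _ fun a ha ↦ ?_
  set x := (h * g)⁻¹ * a * (h * g) with hx
  have hxA : x ∈ A := by
    simpa [hx, mul_assoc] using (inferInstance : A.Normal).conj_mem a ha (h * g)⁻¹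
  have h1 : (g * h) * x * (g * h)⁻¹ = x ^ (m * k) := by
    calc _ = g * (h * x * h⁻¹) * g⁻¹ := by group
      _ = _ := by rw [hm x hxA, ← conj_zpow, hk x hxA, ← zpow_mul, mul_comm]
  have h2 : (h * g) * x * (h * g)⁻¹ = x ^ (m * k) := by
    calc _ = h * (g * x * g⁻¹) * h⁻¹ := by group
      _ = _ := by rw [hk x hxA, ← conj_zpow, hm x hxA, ← zpow_mul]
  have h3 : (h * g) * x * (h * g)⁻¹ = a := by rw [hx]; group
  have h4 : (g * h) * x * (g * h)⁻¹ = a := by rw [h1, ← h2, h3]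
  have h5 : g * h * g⁻¹ * h⁻¹ * a * (g * h * g⁻¹ * h⁻¹)⁻¹ = a := by
    nth_rw 2 [← h4]
    rw [hx]
    group
  nth_rw 1 [← h5]
  group

theorem commute_conj_of_pow_prime_eq_one {G : Type*} [Group G] [Finite G] [Group.IsNilpotent G]
    {A : Subgroup G} [A.Normal] [IsCyclic A] (hA : ∀ c, (∀ a ∈ A, a * c = c * a) → c ∈ A)
    {h : G} {k : ℤ} (hk : ∀ a ∈ A, h * a * h⁻¹ = a ^ k) {l : ℕ} (hl : l.Prime) (hhl : h ^ l = 1)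
    (hk4 : k % 4 ≠ 3) (g : G) : Commute h (g * h * g⁻¹) := by
  set b := g * h * g⁻¹ * h⁻¹ with hb
  have hbA : b ∈ A := commutator_mem_of_centralizer_le hA g h
  have hbh : b * h = g * h * g⁻¹ := by rw [hb]; group
  have h1 : b ^ (∑ i ∈ Finset.range l, k ^ i) = 1 := by
    have := mul_pow_eq_zpow_geom_sum_mul (hk b hbA) l
    rwa [hbh, conj_pow, hhl, mul_one, mul_one, mul_inv_cancel, eq_comm] at this
  obtain ⟨c, hc⟩ := exists_zpow_sub_one_pow_eq_one hk
  have h2 : (orderOf b : ℤ) ∣ k - 1 := by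
    refine dvd_sub_one_of_dvd_geom_sum hl (orderOf_pos b).ne'
      (orderOf_dvd_iff_zpow_eq_one.2 h1) (fun q hq hqd ↦ ?_) fun _ ↦ hk4
    have := orderOf_dvd_iff_zpow_eq_one.2 (hc b hbA)
    exact (Nat.prime_iff_prime_int.1 hq).dvd_of_dvd_pow
      ((Int.natCast_dvd_natCast.2 hqd).trans this)
  have h3 : h * b * h⁻¹ = b := by
    rw [hk b hbA, ← sub_add_cancel k 1, zpow_add, orderOf_dvd_iff_zpow_eq_one.1 h2, one_mul,
      zpow_one]
  rw [← hbh]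
  exact Commute.mul_right (mul_inv_eq_iff_eq_mul.1 h3) (Commute.refl h)

theorem mod_four_eq_three_of_fixedPoint {G V : Type*} [Group G] [Finite G] [Group.IsNilpotent G]
    [CommGroup V] {φ : G →* MulAut V}
    (hfree : ∀ B : Subgroup G, B.Normal → (∀ a ∈ B, ∀ b ∈ B, a * b = b * a) →
      ∀ a ∈ B, ∀ u, u ≠ 1 → φ a u = u → a = 1)
    {A : Subgroup G} [A.Normal] [IsCyclic A] (hA : ∀ c, (∀ a ∈ A, a * c = c * a) → c ∈ A)
    {v : V} (hv : v ≠ 1) {h : G} (hhv : φ h v = v) (hh : h ≠ 1) {k : ℤ}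
    (hk : ∀ a ∈ A, h * a * h⁻¹ = a ^ k) {l : ℕ} (hl : l.Prime) (hhl : h ^ l = 1) :
    k % 4 = 3 := by
  by_contra hk4
  refine hh (hfree (Subgroup.normalClosure {h}) inferInstance (fun a ha b hb ↦
    mul_comm_of_mem_normalClosure ?_ ha hb) h
    (Subgroup.subset_normalClosure (Set.mem_singleton h)) v hv hhv)
  rintro _ rfl _ rfl g
  exact commute_conj_of_pow_prime_eq_one hA hk hl hhl hk4 g

theorem exists_involution_of_fixedPointFree {G V : Type*} [Group G] [Finite G]
    [Group.IsNilpotent G] [CommGroup V] [Finite V] [Nontrivial V] {φ : G →* MulAut V}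
    (hfree : ∀ B : Subgroup G, B.Normal → (∀ a ∈ B, ∀ b ∈ B, a * b = b * a) →
      ∀ a ∈ B, ∀ u, u ≠ 1 → φ a u = u → a = 1) :
    ∃ (v : V) (s : G), s * s = 1 ∧ ∀ h, φ h v = v → h = 1 ∨ h = s := by
  obtain ⟨A, hAn, hAc, hA⟩ := exists_normal_commutative_centralizer_le G
  have hcyc : IsCyclic A := by
    let _ : CommGroup A :=
      { (inferInstance : Group A) with mul_comm := fun a b ↦ Subtype.ext (hAc a a.2 b b.2) }
    exact isCyclic_of_fixedPointFree (ψ := φ.comp A.subtype) fun a u hu hau ↦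
      Subtype.ext (hfree A hAn hAc a a.2 u hu hau)
  obtain ⟨v, hv⟩ := exists_ne (1 : V)
  have hmulconj : ∀ {x y : G} {k m : ℤ}, (∀ a ∈ A, x * a * x⁻¹ = a ^ k) →
      (∀ a ∈ A, y * a * y⁻¹ = a ^ m) → ∀ a ∈ A, (x * y) * a * (x * y)⁻¹ = a ^ (k * m) := by
    intro x y k m hx hy a ha
    calc _ = x * (y * a * y⁻¹) * x⁻¹ := by group
      _ = _ := by rw [hy a ha, ← conj_zpow, hx a ha, ← zpow_mul]
  have hmul : ∀ {x y : G}, φ x v = v → φ y v = v → φ (x * y) v = v := by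
    intro x y hx hy
    rw [map_mul, MulAut.mul_apply, hy, hx]
  have hpow : ∀ {x : G}, φ x v = v → ∀ j : ℕ, φ (x ^ j) v = v := by
    intro x hx j
    induction j with
    | zero => simp
    | succ j ih => rw [pow_succ]; exact hmul ih hx
  have hsq : ∀ h, φ h v = v → h * h = 1 := by
    intro h hh
    by_contra hne
    obtain ⟨l, hl, hld⟩ := Nat.exists_prime_and_dvd (mt orderOf_eq_one_iff.1 hne)
    obtain ⟨j, hj⟩ := hld
    have hj0 : 0 < j := Nat.pos_of_ne_zero fun h0 ↦ (orderOf_pos (h * h)).ne' (by rw [hj, h0]; rfl)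
    have hjj : (h * h) ^ j = h ^ j * h ^ j := (Commute.refl h).mul_pow j
    obtain ⟨k, hk⟩ := exists_conj_eq_zpow A (h ^ j)
    have hne' : (h * h) ^ j ≠ 1 := fun h0 ↦ by
      have := Nat.le_of_dvd hj0 (orderOf_dvd_of_pow_eq_one h0)
      rw [hj] at this
      nlinarith [hl.two_le]
    have h3 := mod_four_eq_three_of_fixedPoint hfree hA hv (hpow (hmul hh hh) j) hne'
      (k := k * k) (by rw [hjj]; exact hmulconj hk hk) hl
      (by rw [← pow_mul, mul_comm, ← hj, pow_orderOf_eq_one])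
    have : k % 4 = 0 ∨ k % 4 = 1 ∨ k % 4 = 2 ∨ k % 4 = 3 := by lia
    rcases this with h | h | h | h <;> simp [Int.mul_emod, h] at h3
  have hthree : ∀ h, φ h v = v → h ≠ 1 → ∀ k : ℤ, (∀ a ∈ A, h * a * h⁻¹ = a ^ k) → k % 4 = 3 :=
    fun h hhv hh k hk ↦ mod_four_eq_three_of_fixedPoint hfree hA hv hhv hh hk Nat.prime_two
      (by rw [pow_two, hsq h hhv])
  by_cases hex : ∃ s, φ s v = v ∧ s ≠ 1
  · obtain ⟨s, hs, hs1⟩ := hex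
    refine ⟨v, s, hsq s hs, fun h hh ↦ ?_⟩
    by_contra! hne
    obtain ⟨k, hk⟩ := exists_conj_eq_zpow A h
    obtain ⟨m, hm⟩ := exists_conj_eq_zpow A s
    have hhs : h * s ≠ 1 := fun h0 ↦
      hne.2 ((eq_inv_of_mul_eq_one_left h0).trans (eq_inv_of_mul_eq_one_left (hsq s hs)).symm)
    have h1 := hthree h hh hne.1 k hk
    have h2 := hthree s hs hs1 m hm
    have h3 := hthree _ (hmul hh hs) hhs _ (hmulconj hk hm)
    simp [Int.mul_emod, h1, h2] at h3
  · push Not at hex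
    exact ⟨v, 1, mul_one 1, fun h hh ↦ Or.inl (hex h hh)⟩

theorem exists_prime_pow_eq_one_of_irreducible {G V : Type*} [Group G] [CommGroup V] [Finite V]
    [Nontrivial V] {φ : G →* MulAut V} (hirr : IsIrreducibleAction φ) :
    ∃ p : ℕ, p.Prime ∧ p ∣ Nat.card V ∧ ∀ u : V, u ^ p = 1 := by
  obtain ⟨p, hp, hpV⟩ := Nat.exists_prime_and_dvd (Finite.one_lt_card (α := V)).ne'
  refine ⟨p, hp, hpV, fun u ↦ ?_⟩
  have := Fact.mk hp
  obtain ⟨x, hx⟩ := exists_prime_orderOf_dvd_card' p hpV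
  have hmem (w : V) : w ∈ (powMonoidHom p : V →* V).ker ↔ w ^ p = 1 := MonoidHom.mem_ker
  rcases hirr (powMonoidHom p).ker (fun g w hw ↦ by
    rw [hmem] at hw ⊢
    rw [← map_pow, hw, map_one]) with h | h
  · have h1 : x ∈ (powMonoidHom p : V →* V).ker := (hmem x).2 (hx ▸ pow_orderOf_eq_one x)
    rw [h, Subgroup.mem_bot] at h1
    rw [h1, orderOf_one] at hx
    exact absurd hx.symm hp.ne_one
  · rw [← hmem, h]
    trivial

theorem hasQuadraticCharacter_of_irreducible.{u, v} (F : Type*) [Field F] [IsAlgClosed F]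
    [CharZero F] (n : ℕ) : ∀ (G : Type u) (V : Type v) [Group G] [Finite G] [Group.IsNilpotent G]
    [CommGroup V] [Finite V] [Nontrivial V] (φ : G →* MulAut V),
    Nat.card V = n → (Nat.card G).Coprime (Nat.card V) → IsIrreducibleAction φ →
    HasQuadraticCharacter F φ := by
  induction n using Nat.strong_induction_on with
  | _ n ih =>
  suffices hmain : ∀ (G : Type u) (V : Type v) [Group G] [Finite G] [Group.IsNilpotent G]
      [CommGroup V] [Finite V] [Nontrivial V] (φ : G →* MulAut V), Function.Injective φ →
      Nat.card V = n → (Nat.card G).Coprime (Nat.card V) → IsIrreducibleAction φ →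
      HasQuadraticCharacter F φ by
    intro G V _ _ _ _ _ _ φ hn hc hirr
    have hirr' : IsIrreducibleAction (QuotientGroup.kerLift φ) := fun W hW ↦
      hirr W fun g w hw ↦ hW (QuotientGroup.mk g) w hw
    obtain ⟨v, f, hf⟩ := hmain (G ⧸ φ.ker) V (QuotientGroup.kerLift φ)
      (QuotientGroup.kerLift_injective φ) hn
      (hc.coprime_dvd_left (Subgroup.card_quotient_dvd_card _)) hirr'
    exact ⟨v, f, fun g hg u ↦ hf (QuotientGroup.mk g) hg u⟩
  intro G V _ _ _ _ _ _ φ hφ hn hc hirr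
  by_cases hfree : ∀ B : Subgroup G, B.Normal → (∀ a ∈ B, ∀ b ∈ B, a * b = b * a) →
      ∀ a ∈ B, ∀ u, u ≠ 1 → φ a u = u → a = 1
  · obtain ⟨v, s, hs, hst⟩ := exists_involution_of_fixedPointFree hfree
    obtain ⟨p, hp, hpV, hpu⟩ := exists_prime_pow_eq_one_of_irreducible hirr
    have := Fact.mk hp
    obtain ⟨f, hf⟩ := exists_quadraticCharacter_of_involution F p hpu (φ s)
      (fun u ↦ by rw [← MulAut.mul_apply, ← map_mul, hs, map_one, MulAut.one_apply]) (by
        by_contra! hne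
        have hs1 : s ≠ 1 := fun h ↦ hne.2 (by rw [h, map_one])
        have h2 : 2 ∣ Nat.card G := by
          have : orderOf s = 2 := orderOf_eq_prime (by rwa [pow_two]) hs1
          exact this ▸ orderOf_dvd_natCard s
        exact Nat.not_coprime_of_dvd_of_dvd one_lt_two h2 (hne.1 ▸ hpV) hc)
    refine ⟨v, f, fun g hg u ↦ ?_⟩
    rcases hst g hg with rfl | rfl
    · rw [map_one, MulAut.one_apply]
    · exact hf u
  · push Not at hfree
    obtain ⟨A, hAn, hA, a, haA, u, hu, hau, ha⟩ := hfree
    obtain ⟨N, W, hW, hWn, hWlt, hWirr, himp⟩ :=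
      exists_hasQuadraticCharacter_imp (F := F) hφ hc hirr hAn hA haA ha hu hau
    exact himp (ih _ (hn ▸ hWlt) N W _ rfl ((hc.coprime_dvd_left
      (Subgroup.card_subgroup_dvd_card N)).coprime_dvd_right
      (Subgroup.card_subgroup_dvd_card W)) hWirr)

/-- Let `G` be a finite nilpotent group acting faithfully on a finite abelian group `V`,
with `gcd(|G|, |V|) = 1`. Then the number of conjugacy classes of the semidirect
product `G ⋉ V` is at most `|V|`. -/
theorem stmt_2 (G V : Type*) [Group G] [Finite G] [Group.IsNilpotent G]
    [CommGroup V] [Finite V] (φ : G →* MulAut V)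
    (hfaithful : Function.Injective φ)
    (hcoprime : Nat.Coprime (Nat.card G) (Nat.card V)) :
    Nat.card (ConjClasses (V ⋊[φ] G)) ≤ Nat.card V := by
  refine card_conjClasses_semidirectProduct_le_of_irreducible ?_ G V φ hfaithful hcoprime
  intro G V _ _ _ _ _ _ φ hφ hc hirr
  obtain ⟨p, hp, hpV, hpu⟩ := exists_prime_pow_eq_one_of_irreducible hirr
  have := Fact.mk hp
  obtain ⟨v, f, hf⟩ :=
    hasQuadraticCharacter_of_irreducible (AlgebraicClosure ℚ) _ G V φ rfl hc hirr
  have : Algebra.IsAlgebraic ℚ (AlgebraicClosure ℚ) := by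
    convert AlgebraicClosure.isAlgebraic ℚ
    · rfl
    · exact Subsingleton.elim _ _
  exact card_conjClasses_le_of_quadraticCharacter hφ (fun u ↦ ⟨1, by rw [pow_one, hpu]⟩) hc
    (hc.coprime_dvd_right hpV).symm v f hf
end

section
/- Let G be a finite group with Frattini subgroup Φ(G) = 1 and whose Fitting subgroup F = F(G) contains every minimal normal subgroup of G (for instance, if all minimal normal subgroups of G are solvable). Then C_G(F) = F, i.e., the centralizer of the Fitting subgroup in G equals the Fitting subgroup itself. -/
/-- The Fitting subgroup `F(G)`: the largest normal nilpotent subgroup of `G`,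
realized as the join of all normal nilpotent subgroups. -/
def fittingSubgroup (G : Type*) [Group G] : Subgroup G :=
  ⨆ (H : Subgroup G) (_ : H.Normal) (_ : Group.IsNilpotent H), H

open Subgroup

/-- **Dedekind's modular law** for a normal subgroup. -/
theorem sup_inf_assoc_of_normal {G : Type*} [Group G] {A : Subgroup G} [A.Normal]
    (B : Subgroup G) {C : Subgroup G} (h : A ≤ C) : A ⊔ B ⊓ C = (A ⊔ B) ⊓ C := by
  apply SetLike.coe_injective
  rw [normal_mul, mul_inf_assoc A B C h, coe_inf, normal_mul]

theorem inf_normal_of_le_centralizer {G : Type*} [Group G] {A K C : Subgroup G} [C.Normal]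
    (h : A ⊔ K = ⊤) (hC : C ≤ centralizer (A : Set G)) : (C ⊓ K).Normal := by
  rw [← normalizer_eq_top_iff, eq_top_iff, ← h]
  refine sup_le (le_normalizer_iff.mpr fun a ha c hc => ?_)
    ((le_inf le_normalizer_of_normal le_normalizer).trans inf_normalizer_le_normalizer_inf)
  rw [mem_centralizer_iff.mp (hC hc.1) a ha, mul_inv_cancel_right]
  exact hc

/-- The derived subgroup of a finite nilpotent group consists of non-generators. -/
theorem eq_top_of_sup_commutator_eq_top {H : Type*} [Group H] [Finite H] [Group.IsNilpotent H]
    {L : Subgroup H} (h : L ⊔ commutator H = ⊤) : L = ⊤ := by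
  by_contra hL
  obtain ⟨N, hN, hLN⟩ := (eq_top_or_exists_le_coatom L).resolve_left hL
  have hNn : N.Normal := NormalizerCondition.normal_of_coatom N
    Group.normalizerCondition_of_isNilpotent hN
  have : Nontrivial (H ⧸ N) := QuotientGroup.nontrivial_iff.mpr hN.1
  have hlt := Group.IsSolvable.commutator_lt_top_of_nontrivial (H ⧸ N)
  have hmap : map (QuotientGroup.mk' N) (L ⊔ commutator H) = commutator (H ⧸ N) := by
    rw [Subgroup.map_sup, (Subgroup.map_eq_bot_iff L).mpr (by simpa using hLN), bot_sup_eq,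
      commutator_def, map_commutator,
      Subgroup.map_top_of_surjective _ (QuotientGroup.mk'_surjective N), commutator_def]
  rw [h, Subgroup.map_top_of_surjective _ (QuotientGroup.mk'_surjective N)] at hmap
  exact hlt.ne hmap.symm

theorem commutator_self_le_frattini {G : Type*} [Group G] [Finite G] (H : Subgroup G)
    [H.Normal] [Group.IsNilpotent H] : ⁅H, H⁆ ≤ frattini G := by
  refine le_iInf₂ fun M hM => ?_
  by_contra hD
  have hDM : ⁅H, H⁆ ⊔ M = ⊤ := hM.2 _ (right_lt_sup.mpr hD)
  have hH : ⁅H, H⁆ ⊔ M ⊓ H = H := by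
    rw [sup_inf_assoc_of_normal M H.commutator_le_self, hDM, top_inf_eq]
  have hL : M.subgroupOf H = ⊤ := by
    apply eq_top_of_sup_commutator_eq_top
    apply Subgroup.map_injective H.subtype_injective
    rw [Subgroup.map_sup, map_subtype_commutator, subgroupOf_map_subtype, sup_comm, hH,
      ← MonoidHom.range_eq_map, H.range_subtype]
  exact hD (H.commutator_le_self.trans (subgroupOf_eq_top.mp hL))

theorem isNilpotent_sup_of_commutator_eq_bot {G : Type*} [Group G] (A B : Subgroup G)
    [A.Normal] [B.Normal] (hA : ⁅A, A⁆ = ⊥) (hB : ⁅B, B⁆ = ⊥) :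
    Group.IsNilpotent (A ⊔ B : Subgroup G) := by
  have key : ∀ (A B : Subgroup G) [A.Normal], ⁅B, B⁆ = ⊥ → ⁅A ⊔ B, A ⊔ B⁆ ≤ A := by
    intro A B _ hB
    have h : map (QuotientGroup.mk' A) ⁅A ⊔ B, A ⊔ B⁆ = ⊥ := by
      rw [map_commutator, Subgroup.map_sup, (Subgroup.map_eq_bot_iff A).mpr (by simp), bot_sup_eq,
        ← map_commutator, hB, Subgroup.map_bot]
    simpa using (Subgroup.map_eq_bot_iff _).mp h
  have h₁ := key A B hB
  have h₂ : ⁅A ⊔ B, A ⊔ B⁆ ≤ B := by simpa only [sup_comm] using key B A hA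
  refine isNilpotent_of_lowerCentralSeries_eq_bot (n := 2) ?_
  rw [Subgroup.lowerCentralSeries_succ, Subgroup.lowerCentralSeries_succ,
    Subgroup.lowerCentralSeries_zero,
    commutator_comm, commutator_eq_bot_iff_le_centralizer]
  exact sup_le ((commutator_eq_bot_iff_le_centralizer.mp hA).trans (centralizer_le h₁))
    ((commutator_eq_bot_iff_le_centralizer.mp hB).trans (centralizer_le h₂))

instance fittingSubgroup_normal (G : Type*) [Group G] : (fittingSubgroup G).Normal := by
  have h (H : Subgroup G) (hH : H.Normal) : (⨆ _ : Group.IsNilpotent H, H).Normal :=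
    iSup_normal _
  have h' (H : Subgroup G) : (⨆ (_ : H.Normal) (_ : Group.IsNilpotent H), H).Normal :=
    @iSup_normal _ _ _ _ (h H)
  exact iSup_normal _

theorem fittingSubgroup_le_centralizer {G : Type*} [Group G] [Finite G]
    (h : frattini G = ⊥) : fittingSubgroup G ≤ centralizer (fittingSubgroup G : Set G) := by
  have habel : ∀ H : Subgroup G, H.Normal → Group.IsNilpotent H → ⁅H, H⁆ = ⊥ :=
    fun H _ _ => le_bot_iff.mp (h ▸ commutator_self_le_frattini H)
  refine iSup_le fun A => iSup₂_le fun hA hA' => ?_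
  rw [le_centralizer_iff]
  refine iSup_le fun B => iSup₂_le fun hB hB' => ?_
  have hn := isNilpotent_sup_of_commutator_eq_bot A B (habel A hA hA') (habel B hB hB')
  rw [← commutator_eq_bot_iff_le_centralizer, eq_bot_iff, ← habel _ inferInstance hn]
  exact commutator_mono le_sup_right le_sup_left

/-- Complements of abelian normal subgroups in a finite group with trivial Frattini subgroup. -/
theorem exists_isCompl_of_frattini_eq_bot {G : Type*} [Group G] [Finite G]
    (h : frattini G = ⊥) (A : Subgroup G) [A.Normal] (hA : A ≤ centralizer (A : Set G)) :
    ∃ K : Subgroup G, IsCompl A K := by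
  obtain ⟨K, hK, hmin⟩ := exists_minimal_of_wellFoundedLT (fun K : Subgroup G => A ⊔ K = ⊤)
    ⟨⊤, sup_top_eq A⟩
  refine ⟨K, disjoint_iff.mpr ?_, codisjoint_iff.mpr hK⟩
  have hn : (A ⊓ K).Normal := inf_normal_of_le_centralizer hK hA
  rw [eq_bot_iff, ← h]
  refine le_iInf₂ fun M hM => ?_
  by_contra hD
  have hDM : A ⊓ K ⊔ M = ⊤ := hM.2 _ (right_lt_sup.mpr hD)
  have hMK : A ⊓ K ⊔ M ⊓ K = K := by
    rw [sup_inf_assoc_of_normal M inf_le_right, hDM, top_inf_eq]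
  have hA' : A ⊔ M ⊓ K = ⊤ := by
    rwa [← hMK, ← sup_assoc, sup_inf_self] at hK
  exact hD (inf_le_right.trans ((hmin hA' inf_le_right).trans inf_le_left))

/-- Let `G` be a finite group with `Φ(G) = 1` whose Fitting subgroup `F = F(G)` contains
every minimal normal subgroup of `G`. Then `C_G(F) = F`. -/
theorem stmt_7 (G : Type*) [Group G] [Finite G]
    (hfrattini : frattini G = ⊥)
    (hmin : ∀ N : Subgroup G, N.Normal → N ≠ ⊥ →
      (∀ M : Subgroup G, M.Normal → M < N → M = ⊥) → N ≤ fittingSubgroup G) :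
    Subgroup.centralizer (fittingSubgroup G : Set G) = fittingSubgroup G := by
  set F := fittingSubgroup G
  have hFC : F ≤ centralizer (F : Set G) := fittingSubgroup_le_centralizer hfrattini
  obtain ⟨K, hK⟩ := exists_isCompl_of_frattini_eq_bot hfrattini F hFC
  refine le_antisymm ?_ hFC
  set C := centralizer (F : Set G)
  have hn : (C ⊓ K).Normal := inf_normal_of_le_centralizer hK.sup_eq_top le_rfl
  have hbot : C ⊓ K = ⊥ := by
    by_contra hne
    obtain ⟨N, hle, ⟨hN, hN'⟩, hNmin⟩ := exists_minimal_le_of_wellFoundedLT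
      (fun N : Subgroup G => N.Normal ∧ N ≠ ⊥) (C ⊓ K) ⟨hn, hne⟩
    have hNF : N ≤ F := hmin N hN hN' fun M hM hlt => by
      by_contra hM'
      exact hlt.not_ge (hNmin ⟨hM, hM'⟩ hlt.le)
    exact hN' (le_bot_iff.mp (hK.disjoint hNF (hle.trans inf_le_right)))
  have hC := sup_inf_assoc_of_normal K hFC
  rw [inf_comm, hbot, sup_bot_eq, hK.sup_eq_top, top_inf_eq] at hC
  exact hC.ge
end

section
/- Let q = 2^n + 1 be a Fermat prime, let V be a cyclic group of order q, and let K be a subgroup of order 2^n = q − 1 of the automorphism group of V acting on V (so every nonidentity element of K acts without nontrivial fixed points on V). Let G = K ⋉ V be the semidirect product. Then bcl(G) = q and |G|_2 = 2^n = q − 1 with O_2(G) = 1; in particular |P/O_2(G)| = bcl(G) − 1 for a Sylow 2-subgroup P of G, so the bound |P/O_p(G)| < bcl(G) is sharp. -/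
/-- `pCore p G` is the `p`-core `O_p(G)` of `G`: the largest normal `p`-subgroup of `G`. -/
def pCore (p : ℕ) (G : Type*) [Group G] : Subgroup G :=
  ⨆ (H : Subgroup G) (_ : H.Normal) (_ : IsPGroup p H), H

/-- `bcl G` is the size of the largest conjugacy class of `G`. -/
noncomputable def bcl (G : Type*) [Group G] : ℕ :=
  ⨆ g : G, Nat.card (conjugatesOf g)

theorem mulAut_mul_comm_of_isCyclic {V : Type*} [Group V] [IsCyclic V] (f g : MulAut V) :
    f * g = g * f := by
  obtain ⟨a, ha⟩ := MonoidHom.map_cyclic f.toMonoidHom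
  ext v
  have ha' : ∀ v, f v = v ^ a := ha
  simp [ha', map_zpow]

section

variable {N K : Type*} [Group N] [Group K] {φ : K →* MulAut N}

theorem right_eq_of_isConj_of_comm (hK : ∀ a b : K, a * b = b * a) {x y : N ⋊[φ] K}
    (h : IsConj x y) : y.right = x.right := by
  obtain ⟨c, rfl⟩ := isConj_iff.mp h
  simp [hK c.right x.right]

theorem card_conjugatesOf_le [Finite N] (hK : ∀ a b : K, a * b = b * a) (g : N ⋊[φ] K) :
    Nat.card (conjugatesOf g) ≤ Nat.card N := by
  refine Nat.card_le_card_of_injective (fun x : conjugatesOf g => x.1.left) ?_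
  rintro ⟨x, hx⟩ ⟨y, hy⟩ hxy
  refine Subtype.ext (SemidirectProduct.ext hxy ?_)
  rw [right_eq_of_isConj_of_comm hK hx, right_eq_of_isConj_of_comm hK hy]

theorem card_le_card_conjugatesOf_inr [Finite N] [Finite K] (k : K)
    (hk : ∀ v : N, φ k v = v → v = 1) :
    Nat.card N ≤ Nat.card (conjugatesOf (SemidirectProduct.inr k : N ⋊[φ] K)) := by
  have : Finite (N ⋊[φ] K) := Finite.of_equiv _ SemidirectProduct.equivProd.symm
  refine Nat.card_le_card_of_injective (fun v : N =>
    (⟨SemidirectProduct.inl v * SemidirectProduct.inr k * (SemidirectProduct.inl v)⁻¹,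
      isConj_iff.mpr ⟨_, rfl⟩⟩ : conjugatesOf (SemidirectProduct.inr k : N ⋊[φ] K))) ?_
  intro v w h
  have h' := congrArg (fun x => x.1.left) h
  simp only [SemidirectProduct.mul_left, SemidirectProduct.left_inl, SemidirectProduct.mul_right,
    SemidirectProduct.right_inl, SemidirectProduct.left_inr, SemidirectProduct.right_inr,
    ← map_inv, map_one, mul_one, one_mul] at h'
  rw [map_inv, map_inv] at h'
  have key : φ k (w⁻¹ * v) = w⁻¹ * v := by
    rw [map_mul, map_inv, eq_comm, ← mul_inv_eq_iff_eq_mul, mul_assoc, h', inv_mul_cancel_left]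
  exact (inv_mul_eq_one.mp (hk _ key)).symm

theorem pCore_eq_bot_of_coprime (p : ℕ) (hcomm : ∀ a b : N, a * b = b * a)
    (hφ : Function.Injective φ) (hp : p.Coprime (Nat.card N)) : pCore p (N ⋊[φ] K) = ⊥ := by
  simp only [pCore, iSup_eq_bot]
  intro H hH hHp
  have hN : ∀ a : N, (SemidirectProduct.inl a : N ⋊[φ] K) ∈ H → a = 1 := by
    intro a ha
    obtain ⟨m, hm⟩ := hHp ⟨_, ha⟩
    have hm' : a ^ p ^ m = 1 := by
      have := congrArg Subtype.val hm
      apply SemidirectProduct.inl_injective (φ := φ)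
      simpa using this
    rw [← orderOf_eq_one_iff]
    exact Nat.eq_one_of_dvd_coprimes (hp.pow_left m) (orderOf_dvd_of_pow_eq_one hm')
      (orderOf_dvd_natCard a)
  rw [Subgroup.eq_bot_iff_forall]
  intro h hh
  have hr : h.right = 1 := by
    apply hφ
    ext v
    have hc : SemidirectProduct.inl v⁻¹ * h * (SemidirectProduct.inl v⁻¹)⁻¹ * h⁻¹ ∈ H :=
      H.mul_mem (hH.conj_mem _ hh _) (H.inv_mem hh)
    have he : SemidirectProduct.inl v⁻¹ * h * (SemidirectProduct.inl v⁻¹)⁻¹ * h⁻¹ =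
        SemidirectProduct.inl (v⁻¹ * h.left * φ h.right v * h.left⁻¹) := by
      ext <;> simp [mul_assoc]
    have hv := hN _ (he ▸ hc)
    rw [hcomm v⁻¹, mul_inv_eq_one, mul_assoc, mul_eq_left, inv_mul_eq_one] at hv
    simpa using hv.symm
  have he : h = SemidirectProduct.inl h.left := by ext <;> simp [hr]
  rw [he] at hh ⊢
  rw [hN _ hh, map_one]

end

/-- Let `q = 2^n + 1` be a Fermat prime, let `V` be cyclic of order `q`, and let `K` be the
subgroup of order `2^n = q - 1` of `Aut(V)`, acting fixed-point-freely on `V`.  For the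
semidirect product `G = K ⋉ V` we have `bcl(G) = q`, `|G|_2 = 2^n = q - 1`, `O_2(G) = 1`,
and `|P / O_2(G)| = bcl(G) - 1` for a Sylow `2`-subgroup `P` of `G`; so the bound
`|P/O_p(G)| < bcl(G)` is sharp. -/
theorem stmt_9 (n : ℕ) (hn : 1 ≤ n) (hq : Nat.Prime (2 ^ n + 1))
    (V : Type*) [Group V] [IsCyclic V] (hV : Nat.card V = 2 ^ n + 1)
    (K : Subgroup (MulAut V)) (hK : Nat.card K = 2 ^ n)
    (hfpf : ∀ k : K, k ≠ 1 → ∀ v : V, (k : MulAut V) v = v → v = 1) :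
    bcl (V ⋊[K.subtype] K) = 2 ^ n + 1 ∧
    pCore 2 (V ⋊[K.subtype] K) = ⊥ ∧
    ∀ P : Sylow 2 (V ⋊[K.subtype] K),
      Nat.card P = 2 ^ n ∧
      ((pCore 2 (V ⋊[K.subtype] K)).subgroupOf (P : Subgroup (V ⋊[K.subtype] K))).index =
        bcl (V ⋊[K.subtype] K) - 1 := by
  have : Finite V := Nat.finite_of_card_ne_zero (by omega)
  have hpow : 2 ≤ 2 ^ n := Nat.le_self_pow (by omega) 2
  have : Finite K := Nat.finite_of_card_ne_zero (by omega)
  have hcomm : ∀ a b : K, a * b = b * a := fun a b =>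
    Subtype.ext (mulAut_mul_comm_of_isCyclic a.1 b.1)
  have hbcl : bcl (V ⋊[K.subtype] K) = 2 ^ n + 1 := by
    have hle : ∀ g : V ⋊[K.subtype] K, Nat.card (conjugatesOf g) ≤ 2 ^ n + 1 := fun g =>
      hV ▸ card_conjugatesOf_le hcomm g
    have : Nontrivial K := Finite.one_lt_card_iff_nontrivial.mp (by omega)
    obtain ⟨k, hk⟩ := exists_ne (1 : K)
    refine le_antisymm (ciSup_le hle) ?_
    refine le_ciSup_of_le ⟨_, Set.forall_mem_range.mpr hle⟩ (SemidirectProduct.inr k) ?_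
    exact hV ▸ card_le_card_conjugatesOf_inr k (hfpf k hk)
  have hodd : Nat.Coprime 2 (2 ^ n + 1) := by
    rw [Nat.coprime_two_left]
    exact (Nat.even_pow.mpr ⟨even_two, by omega⟩).add_one
  have hcore : pCore 2 (V ⋊[K.subtype] K) = ⊥ :=
    pCore_eq_bot_of_coprime 2 IsCyclic.commGroup.mul_comm K.subtype_injective (hV ▸ hodd)
  have : Finite (V ⋊[K.subtype] K) := Finite.of_equiv _ SemidirectProduct.equivProd.symm
  refine ⟨hbcl, hcore, fun P => ?_⟩
  have hP : Nat.card P = 2 ^ n := by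
    rw [P.card_eq_multiplicity, SemidirectProduct.card, hV, hK,
      Nat.factorization_mul (by omega) (by omega), Finsupp.add_apply,
      Nat.factorization_eq_zero_of_not_dvd
        (Nat.prime_two.coprime_iff_not_dvd.mp hodd), Nat.prime_two.factorization_pow]
    simp
  refine ⟨hP, ?_⟩
  rw [hcore, hbcl, Subgroup.bot_subgroupOf, Subgroup.index_bot, hP, Nat.add_sub_cancel]
end
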